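/- arXiv:1702.00446 — 3 statements merged into one kernel-verified Lean document; each statement's English description precedes it below -/
import Mathlib

section
/- Let F_m = F(g_1, …, g_m) be the free group on m generators (m ≥ 2) and let F_m' = [F_m, F_m] be its commutator subgroup. Then F_m' is a free group, freely generated by the nested iterated commutators (g_{k_1}^{n_1}, (g_{k_2}^{n_2}, …, (g_{k_{ℓ-2}}^{n_{ℓ-2}}, (g_j^{n_{ℓ-1}}, g_i^{n_ℓ})) … )) where 2 ≤ ℓ ≤ m, the exponents n_1, …, n_ℓ are arbitrary nonzero integers, the indices satisfy k_1 < k_2 < … < k_{ℓ-2} < j, i < j, and k_s ≠ i for every s. That is, the family of these commutators, indexed by all such data (ℓ; k_1 < … < k_{ℓ-2}; j; i; n_1, …, n_ℓ), is a free basis of the subgroup F_m'. -/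
/-- The commutator `(g, h) = g⁻¹h⁻¹gh` (the convention of the paper). -/
def pcomm {G : Type*} [Group G] (g h : G) : G := g⁻¹ * h⁻¹ * g * h

/-- The index data for a basic iterated commutator
`(g_{k₁}^{n₁}, (g_{k₂}^{n₂}, …, (g_{k_{ℓ-2}}^{n_{ℓ-2}}, (g_j^{n_{ℓ-1}}, g_i^{n_ℓ}))…))`
in the free group on `m` generators: a list `ks = [(k₁, n₁), …, (k_{ℓ-2}, n_{ℓ-2})]` together
with `j`, `i` and the two last exponents, subject to `k₁ < k₂ < ⋯ < k_{ℓ-2} < j`, `i < j`,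
`kₛ ≠ i` for all `s`, all exponents nonzero, and `2 ≤ ℓ ≤ m` (the length of the commutator is
`ℓ = ks.length + 2`). -/
structure CommIndex (m : ℕ) where
  ks : List (Fin m × ℤ)
  j : Fin m
  i : Fin m
  nj : ℤ
  ni : ℤ
  ks_sorted : List.Chain' (· < ·) (ks.map Prod.fst)
  ks_lt_j : ∀ p ∈ ks, p.1 < j
  i_lt_j : i < j
  ks_ne_i : ∀ p ∈ ks, p.1 ≠ i
  ks_exp_ne_zero : ∀ p ∈ ks, p.2 ≠ 0
  nj_ne_zero : nj ≠ 0
  ni_ne_zero : ni ≠ 0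
  len_le : ks.length + 2 ≤ m

/-- The nested iterated commutator
`(g_{k₁}^{n₁}, (g_{k₂}^{n₂}, …, (g_{k_{ℓ-2}}^{n_{ℓ-2}}, (g_j^{n_{ℓ-1}}, g_i^{n_ℓ}))…))`
associated to an index datum. -/
def nestedComm {m : ℕ} (d : CommIndex m) : FreeGroup (Fin m) :=
  d.ks.foldr (fun p w => pcomm (FreeGroup.of p.1 ^ p.2) w)
    (pcomm (FreeGroup.of d.j ^ d.nj) (FreeGroup.of d.i ^ d.ni))

namespace CommIndex

open FreeGroup (of)

variable {m : ℕ}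

/-- The conditions on raw data for being an element of `CommIndex m`, except for the bound on the
length, which follows from them. -/
structure Valid (ks : List (Fin m × ℤ)) (j i : Fin m) (a b : ℤ) : Prop where
  sorted : List.IsChain (· < ·) (ks.map Prod.fst)
  lt_j : ∀ p ∈ ks, p.1 < j
  i_lt_j : i < j
  ne_i : ∀ p ∈ ks, p.1 ≠ i
  exp_ne_zero : ∀ p ∈ ks, p.2 ≠ 0
  nj_ne_zero : a ≠ 0
  ni_ne_zero : b ≠ 0

theorem Valid.length_le {ks : List (Fin m × ℤ)} {j i : Fin m} {a b : ℤ}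
    (h : Valid ks j i a b) : ks.length + 2 ≤ m := by
  have hnd : (i :: j :: ks.map Prod.fst).Nodup := by
    have hks : (ks.map Prod.fst).Nodup :=
      (List.isChain_iff_pairwise.1 h.sorted).imp fun hab => hab.ne
    refine List.nodup_cons.2 ⟨?_, List.nodup_cons.2 ⟨?_, hks⟩⟩
    · intro hi
      rcases List.mem_cons.1 hi with hi | hi
      · exact h.i_lt_j.ne hi
      · obtain ⟨p, hp, hpi⟩ := List.mem_map.1 hi
        exact h.ne_i p hp hpi
    · intro hj
      obtain ⟨p, hp, hpj⟩ := List.mem_map.1 hj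
      exact (h.lt_j p hp).ne hpj
  have := hnd.length_le_card
  simp only [List.length_cons, List.length_map, Fintype.card_fin] at this
  exact this

theorem Valid.cons {ks : List (Fin m × ℤ)} {j i k : Fin m} {a b n : ℤ} (h : Valid ks j i a b)
    (hkj : k < j) (hki : k ≠ i) (hn : n ≠ 0) (hks : ∀ p ∈ ks, k < p.1) :
    Valid ((k, n) :: ks) j i a b where
  sorted := by
    refine List.isChain_iff_pairwise.2 (List.pairwise_cons.2
      ⟨?_, List.isChain_iff_pairwise.1 h.sorted⟩)
    intro l hl
    obtain ⟨p, hp, rfl⟩ := List.mem_map.1 hl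
    exact hks p hp
  lt_j := List.forall_mem_cons.2 ⟨hkj, h.lt_j⟩
  i_lt_j := h.i_lt_j
  ne_i := List.forall_mem_cons.2 ⟨hki, h.ne_i⟩
  exp_ne_zero := List.forall_mem_cons.2 ⟨hn, h.exp_ne_zero⟩
  nj_ne_zero := h.nj_ne_zero
  ni_ne_zero := h.ni_ne_zero

/-- The nested commutator of raw data. -/
def nest (ks : List (Fin m × ℤ)) (j i : Fin m) (a b : ℤ) : FreeGroup (Fin m) :=
  ks.foldr (fun p w => pcomm (of p.1 ^ p.2) w) (pcomm (of j ^ a) (of i ^ b))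

open scoped Classical in
/-- The free generator with the given raw data, or `1` if the data is invalid. -/
noncomputable def gen (ks : List (Fin m × ℤ)) (j i : Fin m) (a b : ℤ) :
    FreeGroup (CommIndex m) :=
  if h : Valid ks j i a b then
    of ⟨ks, j, i, a, b, h.sorted, h.lt_j, h.i_lt_j, h.ne_i, h.exp_ne_zero, h.nj_ne_zero,
      h.ni_ne_zero, h.length_le⟩
  else 1

theorem valid (d : CommIndex m) : Valid d.ks d.j d.i d.nj d.ni :=
  ⟨d.ks_sorted, d.ks_lt_j, d.i_lt_j, d.ks_ne_i, d.ks_exp_ne_zero, d.nj_ne_zero, d.ni_ne_zero⟩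

theorem gen_eq_of (d : CommIndex m) : gen d.ks d.j d.i d.nj d.ni = of d :=
  dif_pos d.valid

theorem lift_gen {ks : List (Fin m × ℤ)} {j i : Fin m} {a b : ℤ} (h : Valid ks j i a b) :
    FreeGroup.lift nestedComm (gen ks j i a b) = nest ks j i a b := by
  rw [gen, dif_pos h, FreeGroup.lift_apply_of]
  rfl

/-- The word in the generators representing the conjugate of a nested commutator by the
monomial `monomial t v`. -/
noncomputable def conjWord (j i : Fin m) (a b : ℤ) (v : Fin m → ℤ) :
    (t : ℕ) → t ≤ m → List (Fin m × ℤ) → FreeGroup (CommIndex m)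
  | 0, _, ks => gen ks j i a b
  | t + 1, h, ks =>
    if v ⟨t, h⟩ = 0 then conjWord j i a b v t (Nat.le_of_succ_le h) ks
    else conjWord j i a b v t (Nat.le_of_succ_le h) ks *
      (conjWord j i a b v t (Nat.le_of_succ_le h) ((⟨t, h⟩, v ⟨t, h⟩) :: ks))⁻¹

/-- The ordered monomial `g_{t-1}^{v_{t-1}} ⋯ g_0^{v_0}`. -/
def monomial (v : Fin m → ℤ) : (t : ℕ) → t ≤ m → FreeGroup (Fin m)
  | 0, _ => 1
  | t + 1, h => of ⟨t, h⟩ ^ v ⟨t, h⟩ * monomial v t (Nat.le_of_succ_le h)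

/-- The word in the generators representing the Schreier element
`(monomial t (v + b eᵢ))⁻¹ * g_i ^ b * monomial t v`, where `v i = 0`. -/
noncomputable def edgeWord (i : Fin m) (b : ℤ) (v : Fin m → ℤ) :
    (t : ℕ) → t ≤ m → FreeGroup (CommIndex m)
  | 0, _ => 1
  | t + 1, h =>
    if i.1 < t ∧ v ⟨t, h⟩ ≠ 0 ∧ b ≠ 0 then
      edgeWord i b v t (Nat.le_of_succ_le h) *
        (conjWord ⟨t, h⟩ i (v ⟨t, h⟩) b v t (Nat.le_of_succ_le h) [])⁻¹
    else edgeWord i b v t (Nat.le_of_succ_le h)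

theorem conjWord_congr {j i : Fin m} {a b : ℤ} {v w : Fin m → ℤ} {t : ℕ} (h : t ≤ m)
    (hvw : ∀ k : Fin m, k.1 < t → v k = w k) (ks : List (Fin m × ℤ)) :
    conjWord j i a b v t h ks = conjWord j i a b w t h ks := by
  induction t generalizing ks with
  | zero => rfl
  | succ t ih =>
    have ih' := ih (Nat.le_of_succ_le h) fun k hk => hvw k (by omega)
    simp only [conjWord, hvw ⟨t, h⟩ (Nat.lt_succ_self t), ih']

theorem monomial_congr {v w : Fin m → ℤ} {t : ℕ} (h : t ≤ m)
    (hvw : ∀ k : Fin m, k.1 < t → v k = w k) : monomial v t h = monomial w t h := by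
  induction t with
  | zero => rfl
  | succ t ih =>
    simp only [monomial, hvw ⟨t, h⟩ (Nat.lt_succ_self t),
      ih (Nat.le_of_succ_le h) fun k hk => hvw k (by omega)]

theorem edgeWord_congr {i : Fin m} {b : ℤ} {v w : Fin m → ℤ} {t : ℕ} (h : t ≤ m)
    (hvw : ∀ k : Fin m, k.1 < t → v k = w k) : edgeWord i b v t h = edgeWord i b w t h := by
  induction t with
  | zero => rfl
  | succ t ih =>
    simp only [edgeWord, hvw ⟨t, h⟩ (Nat.lt_succ_self t),
      ih (Nat.le_of_succ_le h) fun k hk => hvw k (by omega),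
      conjWord_congr (Nat.le_of_succ_le h) fun k hk => hvw k (by omega)]

theorem conjWord_eq_of_le {j i : Fin m} {a b : ℤ} {v : Fin m → ℤ} {s t : ℕ} (hst : s ≤ t)
    (h : t ≤ m) (hv : ∀ k : Fin m, s ≤ k.1 → k.1 < t → v k = 0) (ks : List (Fin m × ℤ)) :
    conjWord j i a b v t h ks = conjWord j i a b v s (hst.trans h) ks := by
  induction t, hst using Nat.le_induction with
  | base => rfl
  | succ t hst ih =>
    rw [conjWord, if_pos (hv ⟨t, h⟩ hst (Nat.lt_succ_self t))]
    exact ih _ fun k hk hk' => hv k hk (by omega)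

theorem edgeWord_eq_of_le {i : Fin m} {b : ℤ} {v : Fin m → ℤ} {s t : ℕ} (hst : s ≤ t)
    (h : t ≤ m) (hv : ∀ k : Fin m, s ≤ k.1 → k.1 < t → v k = 0) :
    edgeWord i b v t h = edgeWord i b v s (hst.trans h) := by
  induction t, hst using Nat.le_induction with
  | base => rfl
  | succ t hst ih =>
    rw [edgeWord, if_neg fun hh => hh.2.1 (hv ⟨t, h⟩ hst (Nat.lt_succ_self t))]
    exact ih _ fun k hk hk' => hv k hk (by omega)

theorem edgeWord_of_le {i : Fin m} {b : ℤ} {v : Fin m → ℤ} {t : ℕ} (h : t ≤ m)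
    (hv : ∀ k : Fin m, i < k → v k = 0) : edgeWord i b v t h = 1 := by
  induction t with
  | zero => rfl
  | succ t ih =>
    rw [edgeWord, if_neg fun hh => hh.2.1 (hv ⟨t, h⟩ hh.1)]
    exact ih _

theorem edgeWord_of_index_ge {i : Fin m} {b : ℤ} {v : Fin m → ℤ} {t : ℕ} (h : t ≤ m)
    (hti : t ≤ i.1) : edgeWord i b v t h = 1 := by
  induction t with
  | zero => rfl
  | succ t ih =>
    rw [edgeWord, if_neg fun hh => by omega]
    exact ih _ (by omega)

theorem edgeWord_zero {i : Fin m} {v : Fin m → ℤ} {t : ℕ} (h : t ≤ m) :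
    edgeWord i 0 v t h = 1 := by
  induction t with
  | zero => rfl
  | succ t ih =>
    rw [edgeWord, if_neg fun hh => hh.2.2 rfl]
    exact ih _

theorem lift_conjWord {ks : List (Fin m × ℤ)} {j i : Fin m} {a b : ℤ} {v : Fin m → ℤ}
    (hvi : v i = 0) {t : ℕ} (h : t ≤ m) (hks : Valid ks j i a b) (htj : t ≤ j.1)
    (htk : ∀ p ∈ ks, t ≤ p.1.1) :
    FreeGroup.lift nestedComm (conjWord j i a b v t h ks) =
      (monomial v t h)⁻¹ * nest ks j i a b * monomial v t h := by
  induction t generalizing ks with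
  | zero => simp [conjWord, monomial, lift_gen hks]
  | succ t ih =>
    have h' := Nat.le_of_succ_le h
    have ih₀ := ih h' hks (by omega) fun p hp => Nat.le_of_succ_le (htk p hp)
    by_cases hv : v ⟨t, h⟩ = 0
    · simp [conjWord, monomial, hv, ih₀]
    · have hc : Valid ((⟨t, h⟩, v ⟨t, h⟩) :: ks) j i a b :=
        hks.cons htj (fun hti => hv (hti ▸ hvi)) hv fun p hp => htk p hp
      have ih₁ := ih h' hc (by omega)
        (List.forall_mem_cons.2 ⟨le_rfl, fun p hp => Nat.le_of_succ_le (htk p hp)⟩)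
      simp only [conjWord, monomial, if_neg hv, map_mul, map_inv, ih₀, ih₁]
      simp only [nest, List.foldr_cons, pcomm]
      group

theorem lift_edgeWord {i : Fin m} {b : ℤ} {v : Fin m → ℤ} (hvi : v i = 0) {t : ℕ} (h : t ≤ m)
    (hit : i.1 < t) :
    FreeGroup.lift nestedComm (edgeWord i b v t h) =
      (monomial (Function.update v i b) t h)⁻¹ * of i ^ b * monomial v t h := by
  induction t with
  | zero => omega
  | succ t ih =>
    have h' := Nat.le_of_succ_le h
    rcases Nat.lt_succ_iff_lt_or_eq.1 hit with hlt | rfl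
    · have ih₀ := ih h' hlt
      have hne : (⟨t, h⟩ : Fin m) ≠ i := fun hh => by
        rw [← hh] at hlt
        exact lt_irrefl _ hlt
      simp only [edgeWord, monomial, Function.update_of_ne hne]
      by_cases hb : b = 0
      · subst hb
        have : Function.update v i 0 = v := by rw [← hvi, Function.update_eq_self]
        simp [edgeWord_zero, this]
      by_cases hv : v ⟨t, h⟩ = 0
      · simp [hv, ih₀]
      · rw [if_pos ⟨hlt, hv, hb⟩, map_mul, map_inv, ih₀,
          lift_conjWord hvi h' ⟨by simp, by simp, hlt, by simp, by simp, hv, hb⟩ le_rfl (by simp)]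
        simp only [nest, List.foldr_nil, pcomm]
        group
    · have hm : monomial (Function.update v i b) i.1 h' = monomial v i.1 h' :=
        monomial_congr h' fun k hk => Function.update_of_ne (Fin.ne_of_lt hk) _ _
      rw [edgeWord, if_neg (by simp), edgeWord_of_index_ge _ le_rfl]
      simp [monomial, hm, hvi]

/-- The edge word along the `i`-th direction starting from the hyperplane `v i = 0`. -/
noncomputable def potential (i : Fin m) (v : Fin m → ℤ) (b : ℤ) : FreeGroup (CommIndex m) :=
  edgeWord i b (Function.update v i 0) m le_rfl

theorem potential_zero (i : Fin m) (v : Fin m → ℤ) : potential i v 0 = 1 :=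
  edgeWord_zero _

theorem potential_add_single (i : Fin m) (v : Fin m → ℤ) (n b : ℤ) :
    potential i (v + Pi.single i n : Fin m → ℤ) b = potential i v b := by
  have : Function.update (v + Pi.single i n : Fin m → ℤ) i 0 = Function.update v i 0 := by
    ext k
    by_cases hk : k = i
    · subst hk; simp
    · simp [hk]
  rw [potential, potential, this]

theorem potential_eq_one {i : Fin m} {v : Fin m → ℤ} (hv : ∀ k, i < k → v k = 0) (b : ℤ) :
    potential i v b = 1 :=
  edgeWord_of_le _ fun k hk => by rw [Function.update_of_ne hk.ne', hv k hk]

/-- Translation of the lattice coordinate by the `i`-th basis vector. -/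
def translate (i : Fin m) : Equiv.Perm (FreeGroup (CommIndex m) × (Fin m → ℤ)) where
  toFun p := (p.1, p.2 + Pi.single i 1)
  invFun p := (p.1, p.2 - Pi.single i 1)
  left_inv p := by simp
  right_inv p := by simp

/-- Left multiplication of the group coordinate by the potential in direction `i`. -/
noncomputable def twist (i : Fin m) : Equiv.Perm (FreeGroup (CommIndex m) × (Fin m → ℤ)) where
  toFun p := (potential i p.2 (p.2 i) * p.1, p.2)
  invFun p := ((potential i p.2 (p.2 i))⁻¹ * p.1, p.2)
  left_inv p := by simp
  right_inv p := by simp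

theorem translate_zpow_apply (i : Fin m) (n : ℤ) (x : FreeGroup (CommIndex m))
    (v : Fin m → ℤ) : (translate i ^ n) (x, v) = (x, v + Pi.single i n) := by
  induction n using Int.induction_on generalizing v with
  | zero => simp
  | succ n ih =>
    rw [zpow_add_one, Equiv.Perm.mul_apply]
    change (translate i ^ (n : ℤ)) (x, v + Pi.single i 1) = _
    rw [ih, add_assoc, ← Pi.single_add, add_comm (1 : ℤ)]
  | pred n ih =>
    rw [zpow_sub_one, Equiv.Perm.mul_apply]
    change (translate i ^ (-n : ℤ)) (x, v - Pi.single i 1) = _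
    rw [ih, sub_eq_add_neg, add_assoc, ← Pi.single_neg, ← Pi.single_add, add_comm (-1 : ℤ)]
    rfl

/-- The action of the free group on the product of the abstract free group with the lattice. -/
noncomputable def latticeAction :
    FreeGroup (Fin m) →* Equiv.Perm (FreeGroup (CommIndex m) × (Fin m → ℤ)) :=
  FreeGroup.lift fun i => twist i * translate i * (twist i)⁻¹

theorem latticeAction_of_zpow (i : Fin m) (n : ℤ) (x : FreeGroup (CommIndex m))
    (v : Fin m → ℤ) :
    latticeAction (of i ^ n) (x, v) =
      (potential i v (v i + n) * (potential i v (v i))⁻¹ * x, v + Pi.single i n) := by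
  rw [map_zpow, latticeAction, FreeGroup.lift_apply_of, conj_zpow, Equiv.Perm.mul_apply,
    Equiv.Perm.mul_apply]
  change twist i ((translate i ^ n) ((potential i v (v i))⁻¹ * x, v)) = _
  rw [translate_zpow_apply]
  change (potential i (v + Pi.single i n) ((v + Pi.single i n : Fin m → ℤ) i) *
    ((potential i v (v i))⁻¹ * x), v + Pi.single i n) = _
  rw [potential_add_single]
  simp [mul_assoc]

theorem latticeAction_of_zpow_of_forall {i : Fin m} {v : Fin m → ℤ}
    (hv : ∀ k, i < k → v k = 0) (n : ℤ) (x : FreeGroup (CommIndex m)) :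
    latticeAction (of i ^ n) (x, v) = (x, v + Pi.single i n) := by
  rw [latticeAction_of_zpow, potential_eq_one hv, potential_eq_one hv]
  simp

theorem latticeAction_pcomm_of {j i : Fin m} (hij : i < j) {a b : ℤ} (ha : a ≠ 0) (hb : b ≠ 0)
    {v : Fin m → ℤ} (hv : ∀ k, j ≤ k → v k = 0) (hvi : v i = 0) (x : FreeGroup (CommIndex m)) :
    latticeAction (pcomm (of j ^ a) (of i ^ b)) (x, v) =
      (conjWord j i a b v j.1 j.2.le [] * x, v) := by
  have hvb : ∀ k, j < k → (v + Pi.single i b : Fin m → ℤ) k = 0 := fun k hk => by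
    simp [hv k hk.le, (hij.trans hk).ne']
  have hva : ∀ k, j < k → (v + Pi.single j a : Fin m → ℤ) k = 0 := fun k hk => by
    simp [hv k hk.le, hk.ne']
  have hpv : potential i v b = edgeWord i b v j.1 j.2.le := by
    rw [potential, ← hvi, Function.update_eq_self]
    exact edgeWord_eq_of_le j.2.le _ fun k hk _ => hv k hk
  have hpa : potential i (v + Pi.single j a : Fin m → ℤ) b =
      edgeWord i b v j.1 j.2.le * (conjWord j i a b v j.1 j.2.le [])⁻¹ := by
    have hagree : ∀ k : Fin m, k.1 < j.1 → (v + Pi.single j a : Fin m → ℤ) k = v k := fun k hk => by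
      simp [Fin.ne_of_lt hk]
    have hi0 : (v + Pi.single j a : Fin m → ℤ) i = 0 := by rw [hagree i hij, hvi]
    have hj : (v + Pi.single j a : Fin m → ℤ) j = a := by simp [hv j le_rfl]
    rw [potential, ← hi0, Function.update_eq_self,
      edgeWord_eq_of_le (s := j.1 + 1) j.2 le_rfl fun k hk _ => hva k hk, edgeWord]
    simp only [Fin.eta, hj]
    rw [if_pos ⟨hij, ha, hb⟩, edgeWord_congr _ hagree, conjWord_congr _ hagree]
  have hvab : v + Pi.single i b + Pi.single j a = v + Pi.single j a + Pi.single i b :=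
    add_right_comm _ _ _
  have hcancel : ∀ (w : Fin m → ℤ) (k : Fin m) (n : ℤ),
      w + Pi.single k n + Pi.single k (-n) = w := fun w k n => by
    rw [add_assoc, ← Pi.single_add]; simp
  rw [pcomm, ← zpow_neg, ← zpow_neg]
  simp only [map_mul, Equiv.Perm.mul_apply]
  rw [latticeAction_of_zpow i b, latticeAction_of_zpow_of_forall hvb, hvab,
    latticeAction_of_zpow i (-b), hcancel, latticeAction_of_zpow_of_forall hva, hcancel]
  have hval : (v + Pi.single j a + Pi.single i b : Fin m → ℤ) i = b := by simp [hvi, hij.ne]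
  rw [hval, hvi, potential_add_single, potential_add_single, zero_add, add_neg_cancel,
    potential_zero, potential_zero, hpv, hpa]
  simp [mul_assoc]

theorem latticeAction_nest {ks : List (Fin m × ℤ)} {j i : Fin m} {a b : ℤ}
    (hks : Valid ks j i a b) {t : ℕ} (h : t ≤ m) (htj : t ≤ j.1) (htk : ∀ p ∈ ks, t ≤ p.1.1)
    {v : Fin m → ℤ} (hv : ∀ k : Fin m, t ≤ k.1 → v k = 0) (hvi : v i = 0)
    (x : FreeGroup (CommIndex m)) :
    latticeAction (nest ks j i a b) (x, v) = (conjWord j i a b v t h ks * x, v) := by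
  induction ks generalizing t v x with
  | nil =>
    rw [nest, List.foldr_nil, latticeAction_pcomm_of hks.i_lt_j hks.nj_ne_zero hks.ni_ne_zero
      (fun k hk => hv k (htj.trans hk)) hvi,
      conjWord_eq_of_le htj j.2.le fun k hk _ => hv k hk]
  | cons q ks ih =>
    obtain ⟨k, n⟩ := q
    have hchain := List.pairwise_cons.1 (List.isChain_iff_pairwise.1 hks.sorted)
    have hks' : Valid ks j i a b :=
      ⟨List.isChain_iff_pairwise.2 hchain.2, fun p hp => hks.lt_j p (List.mem_cons_of_mem _ hp),
        hks.i_lt_j, fun p hp => hks.ne_i p (List.mem_cons_of_mem _ hp),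
        fun p hp => hks.exp_ne_zero p (List.mem_cons_of_mem _ hp), hks.nj_ne_zero,
        hks.ni_ne_zero⟩
    have hkj : k < j := hks.lt_j _ List.mem_cons_self
    have hki : k ≠ i := hks.ne_i _ List.mem_cons_self
    have hn : n ≠ 0 := hks.exp_ne_zero _ List.mem_cons_self
    have htk' : t ≤ k.1 := htk _ List.mem_cons_self
    have hkks : ∀ p ∈ ks, k.1 + 1 ≤ p.1.1 := fun p hp => hchain.1 _ (List.mem_map_of_mem hp)
    have hvk : ∀ l : Fin m, k.1 < l.1 → v l = 0 := fun l hl => hv l (htk'.trans hl.le)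
    have hwk : ∀ l : Fin m, k.1 < l.1 → (v + Pi.single k n : Fin m → ℤ) l = 0 := fun l hl => by
      simp [hvk l hl, Fin.ne_of_gt hl]
    have hwi : (v + Pi.single k n : Fin m → ℤ) i = 0 := by simp [hvi, hki.symm]
    have hagree : ∀ l : Fin m, l.1 < k.1 → (v + Pi.single k n : Fin m → ℤ) l = v l := fun l hl => by
      simp [Fin.ne_of_lt hl]
    have hwkk : (v + Pi.single k n : Fin m → ℤ) k = n := by simp [hv k htk']
    have hcancel : v + Pi.single k n + Pi.single k (-n) = v := by
      rw [add_assoc, ← Pi.single_add]; simp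
    have ih₀ := fun y => ih hks' (t := k.1) k.2.le hkj.le
      (fun p hp => Nat.le_of_succ_le (hkks p hp)) (fun l hl => hv l (htk'.trans hl)) hvi y
    have ih₁ := fun y => ih hks' (t := k.1 + 1) k.2 hkj hkks hwk hwi y
    have ih₂ : ∀ y, (latticeAction (nest ks j i a b))⁻¹ (y, v + Pi.single k n) =
        ((conjWord j i a b (v + Pi.single k n) (k.1 + 1) k.2 ks)⁻¹ * y, v + Pi.single k n) :=
      fun y => by rw [Equiv.Perm.inv_eq_iff_eq, ih₁, mul_inv_cancel_left]
    have hstep : conjWord j i a b (v + Pi.single k n) (k.1 + 1) k.2 ks =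
        conjWord j i a b v k.1 k.2.le ks *
          (conjWord j i a b v k.1 k.2.le ((k, n) :: ks))⁻¹ := by
      rw [conjWord]
      simp only [Fin.eta, hwkk]
      rw [if_neg hn, conjWord_congr _ hagree, conjWord_congr _ hagree]
    change latticeAction (pcomm (of k ^ n) (nest ks j i a b)) (x, v) = _
    rw [pcomm, ← zpow_neg]
    simp only [map_mul, map_inv, Equiv.Perm.mul_apply]
    rw [ih₀, latticeAction_of_zpow_of_forall hvk, ih₂, latticeAction_of_zpow_of_forall hwk,
      hcancel, hstep, ← conjWord_eq_of_le htk' k.2.le fun l hl _ => hv l hl]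
    simp [mul_assoc]

theorem latticeAction_nestedComm (d : CommIndex m) (x : FreeGroup (CommIndex m)) :
    latticeAction (nestedComm d) (x, 0) = (of d * x, 0) := by
  have := latticeAction_nest d.valid (t := 0) (Nat.zero_le _) (Nat.zero_le _)
    (fun _ _ => Nat.zero_le _) (v := 0) (fun _ _ => rfl) rfl x
  rw [conjWord, gen_eq_of] at this
  exact this

theorem latticeAction_lift_nestedComm (y x : FreeGroup (CommIndex m)) :
    latticeAction (FreeGroup.lift nestedComm y) (x, 0) = (y * x, 0) := by
  induction y using FreeGroup.induction_on generalizing x with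
  | C1 => simp
  | of d => rw [FreeGroup.lift_apply_of, latticeAction_nestedComm]
  | inv_of d ih => rw [map_inv, map_inv, Equiv.Perm.inv_eq_iff_eq, ih, mul_inv_cancel_left]
  | mul y z ihy ihz => rw [map_mul, map_mul, Equiv.Perm.mul_apply, ihz, ihy, mul_assoc]

/-- The map to the free group intertwining `latticeAction` with left multiplication. -/
def develop (p : FreeGroup (CommIndex m) × (Fin m → ℤ)) : FreeGroup (Fin m) :=
  monomial p.2 m le_rfl * FreeGroup.lift nestedComm p.1

theorem develop_twist (i : Fin m) (p : FreeGroup (CommIndex m) × (Fin m → ℤ)) :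
    develop (twist i p) = of i ^ p.2 i * develop (p.1, Function.update p.2 i 0) := by
  change monomial p.2 m le_rfl *
    FreeGroup.lift nestedComm (potential i p.2 (p.2 i) * p.1) = _
  rw [map_mul, potential, lift_edgeWord (Function.update_self _ _ _) le_rfl i.2,
    Function.update_idem, Function.update_eq_self, develop]
  simp [mul_assoc]

theorem develop_latticeAction_of (i : Fin m) (p : FreeGroup (CommIndex m) × (Fin m → ℤ)) :
    develop (latticeAction (of i) p) = of i * develop p := by
  obtain ⟨q, rfl⟩ := (twist i).surjective p
  rw [latticeAction, FreeGroup.lift_apply_of, Equiv.Perm.mul_apply, Equiv.Perm.mul_apply,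
    Equiv.Perm.inv_def, Equiv.symm_apply_apply, develop_twist, develop_twist]
  have : Function.update (translate i q).2 i 0 = Function.update q.2 i 0 := by
    ext k
    by_cases hk : k = i
    · subst hk; simp
    · simp [translate, hk]
  rw [this]
  simp [translate, zpow_add_one, ← mul_assoc, (Commute.self_zpow (of i) (q.2 i)).eq]

theorem develop_latticeAction (w : FreeGroup (Fin m))
    (p : FreeGroup (CommIndex m) × (Fin m → ℤ)) :
    develop (latticeAction w p) = w * develop p := by
  induction w using FreeGroup.induction_on generalizing p with
  | C1 => simp
  | of i => exact develop_latticeAction_of i p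
  | inv_of i ih => rw [eq_inv_mul_iff_mul_eq, ← ih, map_inv, Equiv.Perm.inv_def, Equiv.apply_symm_apply]
  | mul w z ihw ihz => rw [map_mul, Equiv.Perm.mul_apply, ihw, ihz, mul_assoc]

/-- The exponent sum homomorphism. -/
def exponentSum : FreeGroup (Fin m) →* Multiplicative (Fin m → ℤ) :=
  FreeGroup.lift fun i => Multiplicative.ofAdd (Pi.single i 1)

theorem latticeAction_snd (w : FreeGroup (Fin m))
    (p : FreeGroup (CommIndex m) × (Fin m → ℤ)) :
    (latticeAction w p).2 = p.2 + (exponentSum w).toAdd := by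
  induction w using FreeGroup.induction_on generalizing p with
  | C1 => simp
  | of i =>
    have := latticeAction_of_zpow i 1 p.1 p.2
    rw [zpow_one] at this
    rw [this]
    simp [exponentSum]
  | inv_of i ih =>
    have := ih (latticeAction (of i)⁻¹ p)
    rw [map_inv, Equiv.Perm.inv_def, Equiv.apply_symm_apply] at this
    rw [this, map_inv, map_inv]
    simp
  | mul w z ihw ihz =>
    rw [map_mul, Equiv.Perm.mul_apply, ihw, ihz, map_mul, toAdd_mul, add_assoc,
      add_comm (exponentSum z).toAdd]

open scoped commutatorElement in
theorem pcomm_mem_commutator {G : Type*} [Group G] (g h : G) : pcomm g h ∈ commutator G := by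
  have : pcomm g h = (⁅g⁻¹, h⁻¹⁆ : G) := by simp [pcomm, commutatorElement_def]
  rw [this]
  exact Subgroup.commutator_mem_commutator (Subgroup.mem_top _) (Subgroup.mem_top _)

theorem nestedComm_mem_commutator (d : CommIndex m) :
    nestedComm d ∈ commutator (FreeGroup (Fin m)) := by
  rw [nestedComm]
  cases d.ks <;> exact pcomm_mem_commutator _ _

theorem monomial_zero {t : ℕ} (h : t ≤ m) : monomial (0 : Fin m → ℤ) t h = 1 := by
  induction t with
  | zero => rfl
  | succ t ih => simp [monomial, ih]

theorem mem_range_of_mem_commutator {w : FreeGroup (Fin m)}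
    (hw : w ∈ commutator (FreeGroup (Fin m))) :
    w ∈ (FreeGroup.lift (nestedComm (m := m))).range := by
  have hsum : exponentSum w = 1 := Abelianization.commutator_subset_ker exponentSum hw
  have hsnd : (latticeAction w (1, 0)).2 = 0 := by rw [latticeAction_snd, hsum]; simp
  have hdev := develop_latticeAction w (1, 0)
  rw [develop, develop, hsnd, monomial_zero] at hdev
  exact ⟨(latticeAction w (1, 0)).1, by simpa using hdev⟩

end CommIndex

/-- The commutator subgroup of the free group `F_m` on `m ≥ 2` generators is freely generated
by the nested iterated commutators
`(g_{k₁}^{n₁}, (g_{k₂}^{n₂}, …, (g_{k_{ℓ-2}}^{n_{ℓ-2}}, (g_j^{n_{ℓ-1}}, g_i^{n_ℓ}))…))` with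
`2 ≤ ℓ ≤ m`, nonzero exponents, `k₁ < ⋯ < k_{ℓ-2} < j`, `i < j` and `kₛ ≠ i` for all `s`:
the homomorphism from the free group on the set of such index data to `F_m`, sending each index
to the corresponding commutator, is injective and has image the commutator subgroup `F_m'`. -/
theorem commutator_subgroup_free_group_free_basis (m : ℕ) (hm : 2 ≤ m) :
    Function.Injective (FreeGroup.lift (nestedComm (m := m))) ∧
      (FreeGroup.lift (nestedComm (m := m))).range = commutator (FreeGroup (Fin m)) := by
  refine ⟨fun y z hyz => ?_, le_antisymm ?_ fun w => CommIndex.mem_range_of_mem_commutator⟩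
  · have hy := CommIndex.latticeAction_lift_nestedComm y 1
    rw [hyz, CommIndex.latticeAction_lift_nestedComm] at hy
    simpa using (congrArg Prod.fst hy).symm
  · apply FreeGroup.range_lift_le
    rintro _ ⟨d, rfl⟩
    exact CommIndex.nestedComm_mem_commutator d
end

section
/- Let K be a flag simplicial complex on the vertex set [m], let G_1, …, G_m be nontrivial groups, let G^K be their graph product over K, and let φ : G^K → G_1 × ⋯ × G_m be the canonical projection homomorphism (which restricts to the identity on each G_k). Then the kernel of φ is a free group if and only if the 1-skeleton of K (the simple graph on [m] whose edges are the 2-element faces of K) is a chordal graph. -/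
/-- The relators of the graph product of the groups `G₁, …, G_m` over a simplicial complex `K`
on `m` vertices: the commutators `[g, h]` for `g ∈ Gᵢ`, `h ∈ Gⱼ` and `{i, j}` an edge of `K`,
taken in the free product `G₁ ∗ ⋯ ∗ G_m`. -/
def gpRels (m : ℕ) (K : Finset (Finset (Fin m))) (G : Fin m → Type*) [∀ i, Group (G i)] :
    Set (Monoid.CoprodI G) :=
  { r | ∃ (i j : Fin m) (g : G i) (h : G j), i ≠ j ∧ ({i, j} : Finset (Fin m)) ∈ K ∧
      r = (Monoid.CoprodI.of g)⁻¹ * (Monoid.CoprodI.of h)⁻¹ *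
            Monoid.CoprodI.of g * Monoid.CoprodI.of h }

/-- The graph product `G^K`: the quotient of the free product `G₁ ∗ ⋯ ∗ G_m` by the normal
closure of the commutation relators coming from the edges of `K`. -/
abbrev GraphProduct (m : ℕ) (K : Finset (Finset (Fin m))) (G : Fin m → Type*)
    [∀ i, Group (G i)] : Type _ :=
  Monoid.CoprodI G ⧸ Subgroup.normalClosure (gpRels m K G)

/-- The canonical image of an element `g ∈ Gᵢ` in the graph product `G^K`. -/
def gpOf {m : ℕ} (K : Finset (Finset (Fin m))) (G : Fin m → Type*) [∀ i, Group (G i)]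
    (i : Fin m) (g : G i) : GraphProduct m K G :=
  QuotientGroup.mk (Monoid.CoprodI.of g)

/-- A simple graph is chordal if each of its cycles with at least `4` vertices (equivalently,
of length at least `4`) has a chord: an edge of the graph joining two vertices of the cycle
that are not adjacent in the cycle. -/
def IsChordal {V : Type*} (Γ : SimpleGraph V) : Prop :=
  ∀ (v : V) (c : Γ.Walk v v), c.IsCycle → 4 ≤ c.length →
    ∃ a b : V, a ∈ c.support ∧ b ∈ c.support ∧ Γ.Adj a b ∧ s(a, b) ∉ c.edges

/-- The 1-skeleton of `K`: the simple graph on `[m]` whose edges are the 2-element faces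
of `K`. -/
def oneSkeleton (m : ℕ) (K : Finset (Finset (Fin m))) : SimpleGraph (Fin m) :=
  SimpleGraph.fromRel (fun a b => ({a, b} : Finset (Fin m)) ∈ K)

/-- Two vertices of a geodesic walk that are adjacent in the graph are joined by an edge of
the walk. -/
theorem SimpleGraph.Walk.mem_edges_of_length_eq_dist {V : Type*} {H : SimpleGraph V} {y z : V}
    (p : H.Walk y z) (hp : p.length = H.dist y z) {a b : V} (ha : a ∈ p.support)
    (hb : b ∈ p.support) (hab : H.Adj a b) : s(a, b) ∈ p.edges := by
  obtain ⟨i, hi, hil⟩ := SimpleGraph.Walk.mem_support_iff_exists_getVert.mp ha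
  obtain ⟨j, hj, hjl⟩ := SimpleGraph.Walk.mem_support_iff_exists_getVert.mp hb
  have key : ∀ i j : ℕ, i < j → j ≤ p.length → H.Adj (p.getVert i) (p.getVert j) →
      s(p.getVert i, p.getVert j) ∈ p.edges := by
    intro i j hij hj h
    have h1 := SimpleGraph.dist_le ((p.take i).append (SimpleGraph.Walk.cons h (p.drop j)))
    simp only [SimpleGraph.Walk.length_append, SimpleGraph.Walk.take_length,
      SimpleGraph.Walk.length_cons, SimpleGraph.Walk.drop_length] at h1
    obtain rfl : j = i + 1 := by omega
    have hd : i < p.darts.length := by rw [SimpleGraph.Walk.length_darts]; omega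
    refine List.mem_map.mpr ⟨p.darts[i], List.getElem_mem hd, ?_⟩
    rw [SimpleGraph.Walk.darts_getElem_eq_getVert]
    rfl
  subst hi hj
  rcases lt_trichotomy i j with h | h | h
  · exact key i j h hjl hab
  · subst h; exact absurd rfl hab.ne
  · rw [Sym2.eq_swap]; exact key j i h hil hab.symm

/-- In a chordal graph, two common neighbours of a vertex `v` and of a connected set `C` which
avoids the closed neighbourhood of `v` are adjacent. -/
theorem IsChordal.adj_of_common_nbrs {V : Type*} {Γ : SimpleGraph V} (hΓ : IsChordal Γ)
    (C : Set V) {v y z : V}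
    (hC : ∀ c ∈ C, ∀ d ∈ C, (Γ ⊓ SimpleGraph.fromRel fun a b => a ∈ C ∧ b ∈ C).Reachable c d)
    (hv : ∀ c ∈ C, c ≠ v ∧ ¬ Γ.Adj v c)
    (hvy : Γ.Adj v y) (hvz : Γ.Adj v z) (hyz : y ≠ z)
    (hyC : ∃ c ∈ C, Γ.Adj c y) (hzC : ∃ c ∈ C, Γ.Adj c z) : Γ.Adj y z := by
  by_contra hnadj
  set D : Set V := insert y (insert z C) with hD
  let H : SimpleGraph V := Γ ⊓ SimpleGraph.fromRel fun a b => a ∈ D ∧ b ∈ D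
  have hH : ∀ a b, H.Adj a b ↔ Γ.Adj a b ∧ a ∈ D ∧ b ∈ D := by
    intro a b
    simp only [H, SimpleGraph.inf_adj, SimpleGraph.fromRel_adj]
    constructor
    · rintro ⟨h, -, h1 | h1⟩
      · exact ⟨h, h1⟩
      · exact ⟨h, h1.symm⟩
    · rintro ⟨h, h1⟩
      exact ⟨h, h.ne, Or.inl h1⟩
  have hCH : ∀ c ∈ C, ∀ d ∈ C, H.Reachable c d := by
    intro c hc d hd
    refine (hC c hc d hd).mono ?_
    intro a b hab
    simp only [SimpleGraph.inf_adj, SimpleGraph.fromRel_adj] at hab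
    rw [hH]
    refine ⟨hab.1, ?_⟩
    rcases hab.2.2 with h | h <;> simp [hD, h]
  obtain ⟨c, hc, hcy⟩ := hyC
  obtain ⟨d, hd, hdz⟩ := hzC
  have hr : H.Reachable y z := by
    have h1 : H.Adj y c := (hH _ _).mpr ⟨hcy.symm, by simp [hD], by simp [hD, hc]⟩
    have h2 : H.Adj d z := (hH _ _).mpr ⟨hdz, by simp [hD, hd], by simp [hD]⟩
    exact h1.reachable.trans ((hCH c hc d hd).trans h2.reachable)
  obtain ⟨p, hpath, hlen⟩ := hr.exists_path_of_dist
  have hle : H ≤ Γ := inf_le_left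
  have hsup : ∀ a ∈ p.support, a ∈ D := by
    have : ∀ (a b : V) (q : H.Walk a b), a ∈ D → ∀ x ∈ q.support, x ∈ D := by
      intro a b q
      induction q with
      | nil => intro h x hx; simp at hx; exact hx ▸ h
      | cons h q ih =>
        intro ha x hx
        rw [SimpleGraph.Walk.support_cons, List.mem_cons] at hx
        rcases hx with rfl | hx
        · exact ha
        · exact ih ((hH _ _).mp h).2.2 x hx
    exact this _ _ p (by simp [hD])
  have hvD : v ∉ D := by
    rintro (h | h | h)
    · exact hvy.ne h
    · exact hvz.ne h
    · exact (hv v h).1 rfl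
  have hvp : v ∉ p.support := fun h => hvD (hsup v h)
  have hq2 : 2 ≤ p.length := by
    by_contra hlt
    have : p.length = 0 ∨ p.length = 1 := by omega
    rcases this with h0 | h1
    · exact hyz (SimpleGraph.Walk.eq_of_length_eq_zero h0)
    · exact hnadj (hle (SimpleGraph.Walk.adj_of_length_eq_one h1))
  let q := p.mapLe hle
  have hqs : q.support = p.support := SimpleGraph.Walk.support_mapLe_eq_support ..
  have hqe : q.edges = p.edges := SimpleGraph.Walk.edges_mapLe_eq_edges ..
  have hcyc : (SimpleGraph.Walk.cons hvz.symm (SimpleGraph.Walk.cons hvy q)).IsCycle := by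
    rw [SimpleGraph.Walk.cons_isCycle_iff, SimpleGraph.Walk.cons_isPath_iff]
    refine ⟨⟨hpath.mapLe hle, by rwa [hqs]⟩, ?_⟩
    rw [SimpleGraph.Walk.edges_cons, List.mem_cons, hqe]
    rintro (h | h)
    · rw [Sym2.eq_swap, Sym2.congr_right] at h
      exact hyz h.symm
    · exact hvp (p.snd_mem_support_of_mem_edges h)
  obtain ⟨a, b, ha, hb, hab, hne⟩ := hΓ z _ hcyc (by
    simp only [SimpleGraph.Walk.length_cons, q, SimpleGraph.Walk.length_mapLe]; omega)
  simp only [SimpleGraph.Walk.support_cons, SimpleGraph.Walk.edges_cons, hqs, hqe, List.mem_cons]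
    at ha hb hne
  have hz : z ∈ p.support := p.end_mem_support
  have hvadj : ∀ x ∈ p.support, Γ.Adj v x → x = y ∨ x = z := by
    intro x hx h
    rcases hsup x hx with h1 | h1 | h1
    · exact Or.inl h1
    · exact Or.inr h1
    · exact absurd h (hv x h1).2
  have ha' : a = v ∨ a ∈ p.support := by
    rcases ha with rfl | rfl | h
    · exact Or.inr hz
    · exact Or.inl rfl
    · exact Or.inr h
  have hb' : b = v ∨ b ∈ p.support := by
    rcases hb with rfl | rfl | h
    · exact Or.inr hz
    · exact Or.inl rfl
    · exact Or.inr h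
  rcases ha' with rfl | ha' <;> rcases hb' with rfl | hb'
  · exact hab.ne rfl
  · rcases hvadj b hb' hab with rfl | rfl
    · simp at hne
    · simp [Sym2.eq_swap] at hne
  · rcases hvadj a ha' hab.symm with rfl | rfl
    · simp [Sym2.eq_swap] at hne
    · simp at hne
  · have : H.Adj a b := (hH _ _).mpr ⟨hab, hsup a ha', hsup b hb'⟩
    exact hne (Or.inr (Or.inr (p.mem_edges_of_length_eq_dist hlen ha' hb' this)))

/-- **Dirac's lemma**, relative form: in a chordal graph, if a vertex `v` of a finite set `S` is not
adjacent to all other vertices of `S`, then some vertex of `S` outside the closed neighbourhood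
of `v` is simplicial in `S`. -/
theorem IsChordal.exists_simplicial_not_adj {V : Type*} {Γ : SimpleGraph V}
    (hΓ : IsChordal Γ) (S : Finset V) : ∀ v ∈ S, ∀ x ∈ S, x ≠ v → ¬ Γ.Adj v x →
      ∃ w ∈ S, w ≠ v ∧ ¬ Γ.Adj v w ∧
        ∀ a ∈ S, ∀ b ∈ S, Γ.Adj w a → Γ.Adj w b → a ≠ b → Γ.Adj a b := by
  classical
  induction S using Finset.strongInduction with
  | H S ih =>
  intro v hv x hx hxv hvx
  let H : SimpleGraph V := Γ ⊓ SimpleGraph.fromRel fun a b =>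
    (a ∈ S ∧ a ≠ v ∧ ¬ Γ.Adj v a) ∧ (b ∈ S ∧ b ≠ v ∧ ¬ Γ.Adj v b)
  have hH : ∀ a b, H.Adj a b ↔
      Γ.Adj a b ∧ (a ∈ S ∧ a ≠ v ∧ ¬ Γ.Adj v a) ∧ (b ∈ S ∧ b ≠ v ∧ ¬ Γ.Adj v b) := by
    intro a b
    simp only [H, SimpleGraph.inf_adj, SimpleGraph.fromRel_adj]
    constructor
    · rintro ⟨h, -, h1 | h1⟩
      · exact ⟨h, h1⟩
      · exact ⟨h, h1.symm⟩
    · rintro ⟨h, h1⟩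
      exact ⟨h, h.ne, Or.inl h1⟩
  have hreach : ∀ z, H.Reachable x z → z ∈ S ∧ z ≠ v ∧ ¬ Γ.Adj v z := by
    have : ∀ (a b : V) (q : H.Walk a b), (a ∈ S ∧ a ≠ v ∧ ¬ Γ.Adj v a) →
        (b ∈ S ∧ b ≠ v ∧ ¬ Γ.Adj v b) := by
      intro a b q
      induction q with
      | nil => exact id
      | cons h q ih => exact fun _ => ih ((hH _ _).mp h).2.2
    rintro z ⟨q⟩
    exact this _ _ q ⟨hx, hxv, hvx⟩
  let C : Set V := {z | H.Reachable x z}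
  have hCconn : ∀ c ∈ C, ∀ d ∈ C,
      (Γ ⊓ SimpleGraph.fromRel fun a b => a ∈ C ∧ b ∈ C).Reachable c d := by
    have : ∀ (a b : V) (q : H.Walk a b), H.Reachable x a →
        (Γ ⊓ SimpleGraph.fromRel fun a b => a ∈ C ∧ b ∈ C).Reachable a b := by
      intro a b q
      induction q with
      | nil => exact fun _ => SimpleGraph.Reachable.refl _
      | cons h q ih =>
        intro ha
        have hb := ha.trans h.reachable
        refine SimpleGraph.Reachable.trans (SimpleGraph.Adj.reachable ?_) (ih hb)
        rw [SimpleGraph.inf_adj, SimpleGraph.fromRel_adj]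
        exact ⟨((hH _ _).mp h).1, h.ne, Or.inl ⟨ha, hb⟩⟩
    intro c hc d hd
    obtain ⟨q⟩ := (SimpleGraph.Reachable.symm hc).trans hd
    exact this c d q hc
  let T : Finset V := S.filter fun z => z ∈ C ∨ ∃ c ∈ C, Γ.Adj c z
  have hTS : T ⊆ S := Finset.filter_subset _ _
  have hvT : v ∉ T := by
    simp only [T, Finset.mem_filter, not_and, not_or, not_exists]
    refine fun _ => ⟨fun h => (hreach v h).2.1 rfl, fun c hc hcv => ?_⟩
    exact (hreach c hc).2.2 hcv.symm
  have hxT : x ∈ T := Finset.mem_filter.mpr ⟨hx, Or.inl (SimpleGraph.Reachable.refl x)⟩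
  have hN : ∀ z ∈ T, z ∉ C → Γ.Adj v z ∧ ∃ c ∈ C, Γ.Adj c z := by
    intro z hz hzC
    have hz' := Finset.mem_filter.mp hz
    obtain ⟨c, hc, hcz⟩ := hz'.2.resolve_left hzC
    refine ⟨?_, c, hc, hcz⟩
    by_contra hvz
    refine hzC (SimpleGraph.Reachable.trans hc (SimpleGraph.Adj.reachable ?_))
    refine (hH _ _).mpr ⟨hcz, hreach c hc, hz'.1, ?_, hvz⟩
    rintro rfl
    exact hvT hz
  have hclique : ∀ y ∈ T, y ∉ C → ∀ z ∈ T, z ∉ C → y ≠ z → Γ.Adj y z := by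
    intro y hy hyC z hz hzC hyz
    exact hΓ.adj_of_common_nbrs C hCconn (fun c hc => (hreach c hc).2) (hN y hy hyC).1
      (hN z hz hzC).1 hyz (hN y hy hyC).2 (hN z hz hzC).2
  have hss : T ⊂ S := Finset.ssubset_iff_subset_ne.mpr ⟨hTS, fun h => hvT (h ▸ hv)⟩
  suffices hw : ∃ w ∈ C, ∀ a ∈ T, ∀ b ∈ T, Γ.Adj w a → Γ.Adj w b → a ≠ b → Γ.Adj a b by
    obtain ⟨w, hwC, hw⟩ := hw
    have hwS := hreach w hwC
    refine ⟨w, hwS.1, hwS.2.1, hwS.2.2, fun a ha b hb hwa hwb => ?_⟩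
    exact hw a (Finset.mem_filter.mpr ⟨ha, Or.inr ⟨w, hwC, hwa⟩⟩) b
      (Finset.mem_filter.mpr ⟨hb, Or.inr ⟨w, hwC, hwb⟩⟩) hwa hwb
  by_cases h1 : ∃ n ∈ T, n ∉ C ∧ ∃ t ∈ T, t ≠ n ∧ ¬ Γ.Adj n t
  · obtain ⟨n, hn, hnC, t, ht, htn, hnt⟩ := h1
    obtain ⟨w, hwT, hwn, hnw, hw⟩ := ih T hss n hn t ht htn hnt
    refine ⟨w, ?_, hw⟩
    by_contra hwC
    exact hnw (hclique n hn hnC w hwT hwC hwn.symm)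
  by_cases h2 : ∃ c ∈ T, ∃ t ∈ T, t ≠ c ∧ ¬ Γ.Adj c t
  · obtain ⟨c, hc, t, ht, htc, hct⟩ := h2
    obtain ⟨w, hwT, hwc, hcw, hw⟩ := ih T hss c hc t ht htc hct
    refine ⟨w, ?_, hw⟩
    by_contra hwC
    exact h1 ⟨w, hwT, hwC, c, hc, hwc.symm, fun h => hcw h.symm⟩
  · refine ⟨x, SimpleGraph.Reachable.refl x, fun a ha b hb _ _ hab => ?_⟩
    by_contra hnab
    exact h2 ⟨a, ha, b, hb, hab.symm, hnab⟩

/-- Every nonempty finite set of vertices of a chordal graph contains a vertex that is simplicial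
in it. -/
theorem IsChordal.exists_simplicial {V : Type*} {Γ : SimpleGraph V}
    (hΓ : IsChordal Γ) {S : Finset V} (hS : S.Nonempty) : ∃ w ∈ S,
      ∀ a ∈ S, ∀ b ∈ S, Γ.Adj w a → Γ.Adj w b → a ≠ b → Γ.Adj a b := by
  by_cases h : ∃ v ∈ S, ∃ x ∈ S, x ≠ v ∧ ¬ Γ.Adj v x
  · obtain ⟨v, hv, x, hx, hxv, hvx⟩ := h
    obtain ⟨w, hw, -, -, hws⟩ := hΓ.exists_simplicial_not_adj S v hv x hx hxv hvx
    exact ⟨w, hw, hws⟩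
  · obtain ⟨v, hv⟩ := hS
    refine ⟨v, hv, fun a ha b hb _ _ hab => ?_⟩
    by_contra hnab
    exact h ⟨a, ha, b, hb, hab.symm, hnab⟩

section CompatibleFamilies

variable {V : Type*} [DecidableEq V] {G : V → Type*} [∀ i, Group (G i)]

theorem Pi.mulSingle_mul_update_one (j : V) (p : ∀ i, G i) :
    Pi.mulSingle j (p j) * Function.update p j 1 = p := by
  funext k
  by_cases hk : k = j
  · subst hk; simp
  · simp [hk]

theorem Pi.mulSingle_mul_update_of_ne {i j : V} (hij : i ≠ j) (x : G i) (p : ∀ i, G i) :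
    Pi.mulSingle i x * Function.update p j 1 = Function.update (Pi.mulSingle i x * p) j 1 := by
  funext k
  by_cases hk : k = j
  · subst hk; simp [hij.symm]
  · simp [hk]

/-- A function on a product of groups which is invariant under left translation by the factors
with index in a finite set `L` only depends on the coordinates outside `L`. -/
theorem eq_of_forall_mulSingle_invariant {X : Type*} (L : Finset V) (f : (∀ i, G i) → X)
    (hf : ∀ i ∈ L, ∀ (x : G i) p, f (Pi.mulSingle i x * p) = f p) {p q : ∀ i, G i}
    (hpq : ∀ k, k ∉ L → p k = q k) : f p = f q := by
  induction L using Finset.induction_on generalizing p with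
  | empty => rw [funext fun k => hpq k (Finset.notMem_empty k)]
  | insert j L _ ih =>
    have h1 : Function.update p j (q j) = Pi.mulSingle j (q j * (p j)⁻¹) * p := by
      funext k
      by_cases hk : k = j
      · subst hk; simp
      · simp [hk]
    rw [← hf j (Finset.mem_insert_self j L) (q j * (p j)⁻¹) p, ← h1]
    refine ih (fun i hi => hf i (Finset.mem_insert_of_mem hi)) fun k hk => ?_
    by_cases hkj : k = j
    · subst hkj; simp
    · rw [Function.update_of_ne hkj]
      exact hpq k (by simp [hkj, hk])

variable {X : Type*} [Group X]

/-- A family of `X`-valued cocycles `η i : G i → ∏ G → X` for the left translation actions of the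
groups `G i`, `i ∈ S`, on their product such that the cocycles of `i` and `j` are compatible
with the commutation of `G i` and `G j` whenever `i` and `j` are adjacent in `Γ`. -/
structure IsCompatibleFamily (Γ : SimpleGraph V) (S : Finset V)
    (η : ∀ i, G i → (∀ i, G i) → X) : Prop where
  map_mul : ∀ i ∈ S, ∀ (x y : G i) p, η i (x * y) p = η i x (Pi.mulSingle i y * p) * η i y p
  comm : ∀ i ∈ S, ∀ j ∈ S, Γ.Adj i j → ∀ (x : G i) (y : G j) p,
    η i x (Pi.mulSingle j y * p) * η j y p = η j y (Pi.mulSingle i x * p) * η i x p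

namespace IsCompatibleFamily

variable {Γ : SimpleGraph V} {S : Finset V} {η η' : ∀ i, G i → (∀ i, G i) → X}

theorem mono {T : Finset V} (h : IsCompatibleFamily Γ S η) (hT : T ⊆ S) :
    IsCompatibleFamily Γ T η :=
  ⟨fun i hi => h.map_mul i (hT hi), fun i hi j hj => h.comm i (hT hi) j (hT hj)⟩

theorem map_one (h : IsCompatibleFamily Γ S η) {i : V} (hi : i ∈ S) (p : ∀ i, G i) :
    η i 1 p = 1 := by
  have := h.map_mul i hi 1 1 p
  rw [Pi.mulSingle_one, one_mul, one_mul] at this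
  exact mul_eq_left.mp this.symm

/-- On a clique, every compatible family is a coboundary. -/
theorem exists_coboundary {L : Finset V} (h : IsCompatibleFamily Γ L η)
    (hL : ∀ i ∈ L, ∀ j ∈ L, i ≠ j → Γ.Adj i j) :
    ∃ ψ : (∀ i, G i) → X, ∀ i ∈ L, ∀ (x : G i) p,
      η i x p = ψ (Pi.mulSingle i x * p) * (ψ p)⁻¹ := by
  induction L using Finset.induction_on with
  | empty => exact ⟨fun _ => 1, by simp⟩
  | insert j L hj ih =>
    obtain ⟨ψ, hψ⟩ := ih (h.mono (Finset.subset_insert j L)) fun a ha b hb =>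
      hL a (Finset.mem_insert_of_mem ha) b (Finset.mem_insert_of_mem hb)
    have hjm : j ∈ insert j L := Finset.mem_insert_self j L
    refine ⟨fun p => η j (p j) (Function.update p j 1) * ψ (Function.update p j 1), ?_⟩
    intro i hi x p
    rcases Finset.mem_insert.mp hi with rfl | hiL
    · have h1 : Function.update (Pi.mulSingle i x * p) i 1 = Function.update p i 1 := by
        funext k
        by_cases hk : k = i
        · subst hk; simp
        · simp [hk]
      have h2 := h.map_mul i hi x (p i) (Function.update p i 1)
      rw [Pi.mulSingle_mul_update_one] at h2
      simp only [h1, Pi.mul_apply, Pi.mulSingle_eq_same, h2]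
      group
    · have hij : i ≠ j := fun e => hj (e ▸ hiL)
      have h1 := h.comm i hi j hjm (hL i hi j hjm hij) x (p j) (Function.update p j 1)
      rw [Pi.mulSingle_mul_update_one, hψ i hiL x (Function.update p j 1),
        Pi.mulSingle_mul_update_of_ne hij] at h1
      have h2 : (Pi.mulSingle i x * p) j = p j := by simp [hij.symm]
      simp only [h2]
      rw [eq_mul_inv_of_mul_eq h1]
      group

/-- On a clique `L`, every compatible family is the coboundary of a function which is trivial where
all coordinates in `L` are trivial. -/
theorem exists_normalized_coboundary {L : Finset V} (h : IsCompatibleFamily Γ L η)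
    (hL : ∀ i ∈ L, ∀ j ∈ L, i ≠ j → Γ.Adj i j) :
    ∃ ψ : (∀ i, G i) → X, (∀ p, (∀ k ∈ L, p k = 1) → ψ p = 1) ∧
      ∀ i ∈ L, ∀ (x : G i) p, η i x p = ψ (Pi.mulSingle i x * p) * (ψ p)⁻¹ := by
  obtain ⟨ψ, hψ⟩ := h.exists_coboundary hL
  refine ⟨fun p => ψ p * (ψ fun k => if k ∈ L then 1 else p k)⁻¹, ?_, ?_⟩
  · intro p hp
    have : (fun k => if k ∈ L then 1 else p k) = p := by
      funext k
      split_ifs with hk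
      · exact (hp k hk).symm
      · rfl
    simp only [this, mul_inv_cancel]
  · intro i hi x p
    have : (fun k => if k ∈ L then 1 else (Pi.mulSingle i x * p) k) =
        fun k => if k ∈ L then 1 else p k := by
      funext k
      split_ifs with hk
      · rfl
      · have : k ≠ i := fun e => hk (e ▸ hi)
        simp [this]
    simp only [this]
    rw [hψ i hi]
    group

/-- A compatible family on `S` extends over a new vertex `v` whose neighbours in `S` lie in a
clique `L`, with prescribed values at the points whose coordinates in `v` and `L` are trivial. -/
theorem exists_extension {v : V} {L : Finset V} (h : IsCompatibleFamily Γ S η) (hv : v ∉ S)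
    (hLS : L ⊆ S) (hadj : ∀ j ∈ S, Γ.Adj v j → j ∈ L)
    (hL : ∀ i ∈ L, ∀ j ∈ L, i ≠ j → Γ.Adj i j) (lab : G v → (∀ i, G i) → X) :
    ∃ θ : G v → (∀ i, G i) → X,
      IsCompatibleFamily Γ (insert v S) (Function.update η v θ) ∧
      ∀ y, y ≠ 1 → ∀ p, p v = 1 → (∀ k ∈ L, p k = 1) → θ y p = lab y p := by
  classical
  obtain ⟨ψ, hψ1, hψ⟩ := (h.mono hLS).exists_normalized_coboundary hL
  have hvL : v ∉ L := fun hvL => hv (hLS hvL)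
  let r : (∀ i, G i) → ∀ i, G i := fun p k => if k ∈ L then 1 else p k
  have hr : ∀ i ∈ L, ∀ (x : G i) p, r (Pi.mulSingle i x * p) = r p := by
    intro i hi x p
    funext k
    simp only [r]
    split_ifs with hk
    · rfl
    · have : k ≠ i := fun e => hk (e ▸ hi)
      simp [this]
  have hr1 : ∀ p, (∀ k ∈ L, p k = 1) → r p = p := by
    intro p hp
    funext k
    simp only [r]
    split_ifs with hk
    · exact (hp k hk).symm
    · rfl
  let μ : (∀ i, G i) → X := fun p => if p v = 1 then 1 else lab (p v) (Function.update p v 1)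
  let Ψ : (∀ i, G i) → X := fun p => ψ p * μ (r p)
  let θ : G v → (∀ i, G i) → X := fun y p => Ψ (Pi.mulSingle v y * p) * (Ψ p)⁻¹
  have hΨ : ∀ i ∈ L, ∀ (x : G i) p, η i x p = Ψ (Pi.mulSingle i x * p) * (Ψ p)⁻¹ := by
    intro i hi x p
    simp only [Ψ, hr i hi]
    rw [hψ i hi]
    group
  have hne : ∀ i ∈ S, Function.update η v θ i = η i := fun i hi =>
    Function.update_of_ne (by rintro rfl; exact hv hi) _ _
  have hcomm : ∀ j ∈ S, Γ.Adj v j → ∀ (x : G v) (y : G j) p,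
      θ x (Pi.mulSingle j y * p) * η j y p = η j y (Pi.mulSingle v x * p) * θ x p := by
    intro j hj hvj x y p
    have hvj' : v ≠ j := hvj.ne
    have hjL := hadj j hj hvj
    rw [hΨ j hjL, hΨ j hjL]
    simp only [θ]
    rw [← mul_assoc (Pi.mulSingle v x), ← mul_assoc (Pi.mulSingle j y),
      (Pi.mulSingle_commute hvj' x y).eq]
    group
  refine ⟨θ, ⟨?_, ?_⟩, ?_⟩
  · intro i hi x y p
    rcases Finset.mem_insert.mp hi with rfl | hi
    · rw [Function.update_self]
      simp only [θ]
      rw [Pi.mulSingle_mul, mul_assoc (Pi.mulSingle i x)]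
      group
    · rw [hne i hi]; exact h.map_mul i hi x y p
  · intro i hi j hj hij x y p
    rcases Finset.mem_insert.mp hi with rfl | hi' <;>
      rcases Finset.mem_insert.mp hj with rfl | hj'
    · exact absurd rfl hij.ne
    · rw [Function.update_self, hne j hj']; exact hcomm j hj' hij x y p
    · rw [Function.update_self, hne i hi']; exact (hcomm i hi' hij.symm y x p).symm
    · rw [hne i hi', hne j hj']; exact h.comm i hi' j hj' hij x y p
  · intro y hy p hpv hpL
    have hne' : ∀ k ∈ L, (Pi.mulSingle v y * p) k = 1 := by
      intro k hk
      have : k ≠ v := fun e => hvL (e ▸ hk)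
      simp [this, hpL k hk]
    have hup : Function.update (Pi.mulSingle v y * p) v 1 = p := by
      funext k
      by_cases hk : k = v
      · subst hk; simp [hpv]
      · simp [hk]
    simp only [θ, Ψ]
    rw [hψ1 _ hne', hψ1 _ hpL, hr1 _ hne', hr1 _ hpL]
    simp only [μ, hup]
    simp [hpv, hy]

/-- The extension in `IsCompatibleFamily.exists_extension` is unique. -/
theorem extension_unique {v : V} {L : Finset V} (h : IsCompatibleFamily Γ (insert v S) η)
    (h' : IsCompatibleFamily Γ (insert v S) η') (hLS : L ⊆ S)
    (hadj : ∀ j ∈ L, Γ.Adj v j) (hL : ∀ i ∈ L, ∀ j ∈ L, i ≠ j → Γ.Adj i j)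
    (hS : ∀ i ∈ S, η i = η' i)
    (hlab : ∀ y, y ≠ 1 → ∀ p, p v = 1 → (∀ k ∈ L, p k = 1) → η v y p = η' v y p) :
    η v = η' v := by
  have hLS' : insert v L ⊆ insert v S := Finset.insert_subset_insert v hLS
  have hL' : ∀ i ∈ insert v L, ∀ j ∈ insert v L, i ≠ j → Γ.Adj i j := by
    intro i hi j hj hij
    rcases Finset.mem_insert.mp hi with rfl | hi' <;>
      rcases Finset.mem_insert.mp hj with rfl | hj'
    · exact absurd rfl hij
    · exact hadj j hj'
    · exact (hadj i hi').symm
    · exact hL i hi' j hj' hij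
  obtain ⟨ψ, hψ1, hψ⟩ := (h.mono hLS').exists_normalized_coboundary hL'
  obtain ⟨ψ', hψ1', hψ'⟩ := (h'.mono hLS').exists_normalized_coboundary hL'
  have hvm : v ∈ insert v L := Finset.mem_insert_self v L
  have hvL : v ∉ L := fun hvL => (hadj v hvL).ne rfl
  have hinv : ∀ i ∈ L, ∀ (x : G i) p,
      (ψ' (Pi.mulSingle i x * p))⁻¹ * ψ (Pi.mulSingle i x * p) = (ψ' p)⁻¹ * ψ p := by
    intro i hi x p
    have h1 := hψ i (Finset.mem_insert_of_mem hi) x p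
    rw [hS i (hLS hi), hψ' i (Finset.mem_insert_of_mem hi) x p] at h1
    rw [eq_mul_inv_iff_mul_eq] at h1
    rw [← h1]
    group
  have heq : ∀ p, ψ p = ψ' p := by
    intro p
    let q : ∀ i, G i := fun k => if k ∈ L then 1 else p k
    have h1 := eq_of_forall_mulSingle_invariant L (fun p => (ψ' p)⁻¹ * ψ p) hinv
      (p := p) (q := q) fun k hk => by simp [q, hk]
    have hq1 : ∀ k ∈ insert v L, Function.update q v 1 k = 1 := by
      intro k hk
      by_cases hkv : k = v
      · subst hkv; simp
      · have : k ∈ L := (Finset.mem_insert.mp hk).resolve_left hkv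
        simp [hkv, q, this]
    have h2 := hψ v hvm (q v) (Function.update q v 1)
    have h3 := hψ' v hvm (q v) (Function.update q v 1)
    rw [Pi.mulSingle_mul_update_one, hψ1 _ hq1, inv_one, mul_one] at h2
    rw [Pi.mulSingle_mul_update_one, hψ1' _ hq1, inv_one, mul_one] at h3
    have h4 : η v (q v) (Function.update q v 1) = η' v (q v) (Function.update q v 1) := by
      by_cases hqv : q v = 1
      · rw [hqv, h.map_one (Finset.mem_insert_self v S), h'.map_one (Finset.mem_insert_self v S)]
      · exact hlab _ hqv _ (by simp) fun k hk => hq1 k (Finset.mem_insert_of_mem hk)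
    rw [h2, h3] at h4
    simp only [h4, inv_mul_cancel] at h1
    exact (inv_mul_eq_one.mp h1).symm
  funext y p
  rw [hψ v hvm, hψ' v hvm, heq, heq]

end IsCompatibleFamily

/-- Over a chordal graph, the compatible families are freely determined by their values on the
nontrivial elements of the `G i` at those points whose coordinates at `i` and at the
neighbours of `i` preceding it in a perfect elimination ordering are trivial. -/
theorem IsChordal.exists_unique_compatibleFamily {Γ : SimpleGraph V} (hΓ : IsChordal Γ)
    (S : Finset V) : ∃ L : V → Finset V, ∀ (X : Type*) [Group X],
      (∀ lab : ∀ i, G i → (∀ i, G i) → X, ∃ η, IsCompatibleFamily Γ S η ∧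
        ∀ i ∈ S, ∀ y : G i, y ≠ 1 → ∀ p, p i = 1 → (∀ k ∈ L i, p k = 1) → η i y p = lab i y p) ∧
      ∀ η η' : ∀ i, G i → (∀ i, G i) → X, IsCompatibleFamily Γ S η → IsCompatibleFamily Γ S η' →
        (∀ i ∈ S, ∀ y : G i, y ≠ 1 → ∀ p, p i = 1 → (∀ k ∈ L i, p k = 1) →
          η i y p = η' i y p) → ∀ i ∈ S, η i = η' i := by
  classical
  induction S using Finset.strongInduction with
  | H S ih =>
  rcases S.eq_empty_or_nonempty with rfl | hS
  · refine ⟨fun _ => ∅, fun X _ => ⟨fun lab => ⟨fun _ _ _ => 1, ⟨?_, ?_⟩, ?_⟩, ?_⟩⟩ <;> simp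
  obtain ⟨v, hvS, hv⟩ := hΓ.exists_simplicial hS
  obtain ⟨L, hL⟩ := ih (S.erase v) (Finset.erase_ssubset hvS)
  let N : Finset V := (S.erase v).filter fun j => Γ.Adj v j
  have hNS : N ⊆ S.erase v := Finset.filter_subset _ _
  have hNadj : ∀ j ∈ N, Γ.Adj v j := fun j hj => (Finset.mem_filter.mp hj).2
  have hNS' : ∀ j ∈ N, j ∈ S := fun j hj => Finset.mem_of_mem_erase (hNS hj)
  have hNc : ∀ i ∈ N, ∀ j ∈ N, i ≠ j → Γ.Adj i j := fun i hi j hj =>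
    hv i (hNS' i hi) j (hNS' j hj) (hNadj i hi) (hNadj j hj)
  have hins : insert v (S.erase v) = S := Finset.insert_erase hvS
  have hLne : ∀ i ∈ S.erase v, Function.update L v N i = L i := fun i hi =>
    Function.update_of_ne (Finset.ne_of_mem_erase hi) _ _
  refine ⟨Function.update L v N, fun X _ => ⟨fun lab => ?_, fun η η' h h' hlab => ?_⟩⟩
  · obtain ⟨η, hη, hηlab⟩ := (hL X).1 lab
    obtain ⟨θ, hθ, hθlab⟩ := hη.exists_extension (Finset.notMem_erase v S) hNS
      (fun j hj hvj => Finset.mem_filter.mpr ⟨hj, hvj⟩) hNc (lab v)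
    rw [hins] at hθ
    refine ⟨_, hθ, fun i hi y hy p hpi hpL => ?_⟩
    by_cases hiv : i = v
    · subst hiv
      rw [Function.update_self] at hpL ⊢
      exact hθlab y hy p hpi hpL
    · have hi' := Finset.mem_erase.mpr ⟨hiv, hi⟩
      rw [Function.update_of_ne hiv] at hpL ⊢
      exact hηlab i hi' y hy p hpi hpL
  · have hagree : ∀ i ∈ S.erase v, η i = η' i := by
      refine (hL X).2 η η' (h.mono (Finset.erase_subset v S)) (h'.mono (Finset.erase_subset v S)) ?_
      intro i hi y hy p hpi hpL
      exact hlab i (Finset.mem_of_mem_erase hi) y hy p hpi (by rwa [hLne i hi])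
    intro i hi
    by_cases hiv : i = v
    · subst hiv
      refine IsCompatibleFamily.extension_unique (S := S.erase i) (L := N) (Γ := Γ)
        (by rwa [hins]) (by rwa [hins]) hNS hNadj hNc hagree fun y hy p hp hpN => ?_
      exact hlab i hi y hy p hp (by rwa [Function.update_self])
    · exact hagree i (Finset.mem_erase.mpr ⟨hiv, hi⟩)

end CompatibleFamilies

section Cocycles

variable {m : ℕ} {K : Finset (Finset (Fin m))} {G : Fin m → Type*} [∀ i, Group (G i)]
  {X : Type*} [Group X]

theorem oneSkeleton_adj {i j : Fin m} :
    (oneSkeleton m K).Adj i j ↔ i ≠ j ∧ ({i, j} : Finset (Fin m)) ∈ K := by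
  rw [oneSkeleton, SimpleGraph.fromRel_adj, Finset.pair_comm j i, or_self]

theorem gpOf_mul (i : Fin m) (x y : G i) : gpOf K G i (x * y) = gpOf K G i x * gpOf K G i y := by
  simp [gpOf]

theorem gpOf_comm {i j : Fin m} (h : (oneSkeleton m K).Adj i j) (x : G i) (y : G j) :
    gpOf K G i x * gpOf K G j y = gpOf K G j y * gpOf K G i x := by
  obtain ⟨hij, hK⟩ := oneSkeleton_adj.mp h
  have h1 : (Monoid.CoprodI.of x)⁻¹ * (Monoid.CoprodI.of y)⁻¹ *
      Monoid.CoprodI.of x * Monoid.CoprodI.of y ∈ Subgroup.normalClosure (gpRels m K G) :=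
    Subgroup.subset_normalClosure ⟨i, j, x, y, hij, hK, rfl⟩
  have h2 := (QuotientGroup.eq_one_iff _).mpr h1
  change (gpOf K G i x)⁻¹ * (gpOf K G j y)⁻¹ * gpOf K G i x * gpOf K G j y = 1 at h2
  calc gpOf K G i x * gpOf K G j y = gpOf K G j y * gpOf K G i x *
        ((gpOf K G i x)⁻¹ * (gpOf K G j y)⁻¹ * gpOf K G i x * gpOf K G j y) := by group
    _ = gpOf K G j y * gpOf K G i x := by rw [h2, mul_one]

theorem GraphProduct.induction_on {motive : GraphProduct m K G → Prop} (g : GraphProduct m K G)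
    (one : motive 1) (of : ∀ i x, motive (gpOf K G i x))
    (mul : ∀ g h, motive g → motive h → motive (g * h)) : motive g := by
  induction g using QuotientGroup.induction_on with
  | H g =>
    induction g using Monoid.CoprodI.induction_on with
    | one => exact one
    | of i x => exact of i x
    | mul g h hg hh => exact mul _ _ hg hh

/-- An `X`-valued cocycle for the action of a group on `∏ G` through a homomorphism `φ`. -/
def IsCocycle {A : Type*} [Group A] (φ : A →* ∀ i, G i) (c : A → (∀ i, G i) → X) : Prop :=
  ∀ g h p, c (g * h) p = c g (φ h * p) * c h p

theorem IsCocycle.map_one {A : Type*} [Group A] {φ : A →* ∀ i, G i} {c : A → (∀ i, G i) → X}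
    (hc : IsCocycle φ c) (p : ∀ i, G i) : c 1 p = 1 := by
  have := hc 1 1 p
  rw [_root_.map_one, one_mul, one_mul] at this
  exact mul_eq_left.mp this.symm

variable {φ : GraphProduct m K G →* (∀ i, G i)}

theorem IsCocycle.ext {c c' : GraphProduct m K G → (∀ i, G i) → X} (hc : IsCocycle φ c)
    (hc' : IsCocycle φ c') (h : ∀ i x p, c (gpOf K G i x) p = c' (gpOf K G i x) p) : c = c' := by
  funext g
  induction g using GraphProduct.induction_on with
  | one => funext p; rw [hc.map_one, hc'.map_one]
  | of i x => funext p; exact h i x p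
  | mul g g' hg hg' => funext p; rw [hc, hc', hg, hg']

theorem IsCocycle.isCompatibleFamily
    (hφ : ∀ (i : Fin m) (g : G i), φ (gpOf K G i g) = Pi.mulSingle i g)
    {c : GraphProduct m K G → (∀ i, G i) → X} (hc : IsCocycle φ c) :
    IsCompatibleFamily (oneSkeleton m K) Finset.univ fun i x => c (gpOf K G i x) where
  map_mul i _ x y p := by rw [gpOf_mul, hc, hφ]
  comm i _ j _ hij x y p := by rw [← hφ j, ← hc, gpOf_comm hij, hc, hφ]

theorem IsCompatibleFamily.exists_isCocycle
    (hφ : ∀ (i : Fin m) (g : G i), φ (gpOf K G i g) = Pi.mulSingle i g)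
    {η : ∀ i, G i → (∀ i, G i) → X}
    (h : IsCompatibleFamily (oneSkeleton m K) Finset.univ η) :
    ∃ c : GraphProduct m K G → (∀ i, G i) → X, IsCocycle φ c ∧
      ∀ i x p, c (gpOf K G i x) p = η i x p := by
  let f : ∀ i, G i →* Function.End ((∀ i, G i) × X) := fun i =>
    { toFun := fun x q => (Pi.mulSingle i x * q.1, η i x q.1 * q.2)
      map_one' := by
        funext q
        simp only [Pi.mulSingle_one, one_mul, h.map_one (Finset.mem_univ i)]
        rfl
      map_mul' := by
        intro x y
        funext q
        simp only [h.map_mul i (Finset.mem_univ i), Pi.mulSingle_mul, mul_assoc]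
        rfl }
  let ρ₀ : Monoid.CoprodI G →* Equiv.Perm ((∀ i, G i) × X) :=
    (Monoid.CoprodI.lift f).toHomPerm
  have hρ₀ : ∀ i x q, ρ₀ (Monoid.CoprodI.of (i := i) x) q =
      (Pi.mulSingle i x * q.1, η i x q.1 * q.2) := by
    intro i x q
    change Monoid.CoprodI.lift f (Monoid.CoprodI.of x) q = _
    rw [Monoid.CoprodI.lift_of]
    rfl
  have hker : Subgroup.normalClosure (gpRels m K G) ≤ ρ₀.ker := by
    refine Subgroup.normalClosure_le_normal ?_
    rintro r ⟨i, j, x, y, hij, hK, rfl⟩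
    have hcomm : ρ₀ (Monoid.CoprodI.of x) * ρ₀ (Monoid.CoprodI.of y) =
        ρ₀ (Monoid.CoprodI.of y) * ρ₀ (Monoid.CoprodI.of x) := by
      ext1 q
      rw [Equiv.Perm.mul_apply, Equiv.Perm.mul_apply, hρ₀, hρ₀, hρ₀, hρ₀]
      refine Prod.ext ?_ ?_
      · simp only
        rw [← mul_assoc, (Pi.mulSingle_commute hij x y).eq, mul_assoc]
      · simp only
        rw [← mul_assoc, h.comm i (Finset.mem_univ i) j (Finset.mem_univ j)
          (oneSkeleton_adj.mpr ⟨hij, hK⟩), mul_assoc]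
    rw [SetLike.mem_coe, MonoidHom.mem_ker, _root_.map_mul, _root_.map_mul, _root_.map_mul, _root_.map_inv,
      _root_.map_inv,
      mul_assoc, hcomm]
    group
  let ρ : GraphProduct m K G →* Equiv.Perm ((∀ i, G i) × X) :=
    QuotientGroup.lift _ ρ₀ hker
  have hρ : ∀ i x q, ρ (gpOf K G i x) q = (Pi.mulSingle i x * q.1, η i x q.1 * q.2) := hρ₀
  have hρ' : ∀ g q, ρ g q = (φ g * q.1, (ρ g (q.1, 1)).2 * q.2) := by
    intro g
    induction g using GraphProduct.induction_on with
    | one => simp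
    | of i x => intro q; rw [hρ, hρ, hφ, mul_one]
    | mul g g' hg hg' =>
      intro q
      rw [_root_.map_mul, Equiv.Perm.mul_apply, Equiv.Perm.mul_apply, hg, hg' q, hg (ρ g' (q.1, 1)),
        hg' (q.1, 1)]
      simp [mul_assoc]
  refine ⟨fun g p => (ρ g (p, 1)).2, ?_, ?_⟩
  · intro g g' p
    simp only
    rw [_root_.map_mul, Equiv.Perm.mul_apply, hρ' g, hρ' g' (p, 1)]
  · intro i x p
    simp only
    rw [hρ, mul_one]

theorem surjective_of_gpOf_eq_mulSingle
    (hφ : ∀ (i : Fin m) (g : G i), φ (gpOf K G i g) = Pi.mulSingle i g) :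
    Function.Surjective φ := by
  intro p
  have : p ∈ φ.range := Subgroup.pi_mem_of_mulSingle_mem p fun i => ⟨gpOf K G i (p i), hφ i (p i)⟩
  exact this

end Cocycles

section Chordal

open CategoryTheory

/-- The codomain of a group homomorphism `φ : A →* B`, viewed as the set of objects of the action
groupoid of `A` on `B`. -/
def ActionObj {A B : Type} [Group A] [Group B] (_ : A →* B) : Type := B

namespace ActionObj

variable {A B : Type} [Group A] [Group B] (φ : A →* B)

/-- The element of the group `B` underlying an object. -/
def val {φ : A →* B} (p : ActionObj φ) : B := p

/-- The object given by an element of the group `B`. -/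
def mk (p : B) : ActionObj φ := p

/-- A morphism `p ⟶ q` is an element `g` with `φ g * p = q`. -/
instance : Groupoid (ActionObj φ) where
  Hom p q := { g : A // φ g * p.val = q.val }
  id p := ⟨1, by rw [map_one, one_mul]⟩
  comp g h := ⟨h.1 * g.1, by rw [map_mul, mul_assoc, g.2, h.2]⟩
  id_comp g := Subtype.ext (mul_one _)
  comp_id g := Subtype.ext (one_mul _)
  assoc g h k := Subtype.ext (mul_assoc _ _ _).symm
  inv g := ⟨g.1⁻¹, by rw [map_inv]; exact inv_mul_eq_of_eq_mul g.2.symm⟩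
  inv_comp g := Subtype.ext (mul_inv_cancel _)
  comp_inv g := Subtype.ext (inv_mul_cancel _)

variable {φ}

/-- The morphism given by a group element. -/
def homMk {p q : ActionObj φ} (g : A) (h : φ g * p.val = q.val) : p ⟶ q := ⟨g, h⟩

/-- The group element underlying a morphism. -/
def label {p q : ActionObj φ} (g : p ⟶ q) : A := g.1

theorem label_spec {p q : ActionObj φ} (g : p ⟶ q) : φ (label g) * p.val = q.val := g.2

theorem isConnected (hφ : Function.Surjective φ) : IsConnected (ActionObj φ) :=
  haveI : Nonempty (ActionObj φ) := ⟨mk φ 1⟩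
  zigzag_isConnected fun p q => by
    obtain ⟨g, hg⟩ := hφ (q.val * p.val⁻¹)
    exact Relation.ReflTransGen.single
      (Or.inl ⟨homMk g (by rw [hg, inv_mul_cancel_right])⟩)

/-- The vertex group at the identity is the kernel of the homomorphism. -/
def endEquivKer : End (mk φ 1) ≃* φ.ker where
  toFun f := ⟨label f, (mul_one _).symm.trans (label_spec f)⟩
  invFun g := homMk g.1 (by rw [g.2, one_mul])
  left_inv _ := rfl
  right_inv _ := rfl
  map_mul' _ _ := rfl

end ActionObj

open ActionObj in
/-- If the 1-skeleton is chordal, the kernel of the projection is free: it is a vertex group of the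
action groupoid of the graph product on the direct product, and this groupoid is free. -/
theorem IsChordal.isFreeGroup_ker {m : ℕ} {K : Finset (Finset (Fin m))} {G : Fin m → Type}
    [∀ i, Group (G i)] (hch : IsChordal (oneSkeleton m K))
    (φ : GraphProduct m K G →* (∀ i, G i))
    (hφ : ∀ (i : Fin m) (g : G i), φ (gpOf K G i g) = Pi.mulSingle i g) :
    IsFreeGroup φ.ker := by
  classical
  obtain ⟨L, hL⟩ := hch.exists_unique_compatibleFamily (G := G) Finset.univ
  let _ : IsFreeGroupoid (ActionObj φ) :=
    { quiverGenerators :=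
        ⟨fun p q => { e : Σ i, G i // e.2 ≠ 1 ∧ val p e.1 = 1 ∧
          (∀ k ∈ L e.1, val p k = 1) ∧ φ (gpOf K G e.1 e.2) * val p = val q }⟩
      of := fun e => homMk (gpOf K G e.1.1 e.1.2) e.2.2.2.2
      unique_lift := by
        intro X _ f
        let lab : ∀ i, G i → (∀ i, G i) → X := fun i y p =>
          if h : y ≠ 1 ∧ p i = 1 ∧ (∀ k ∈ L i, p k = 1) then
            @f (mk φ p) (mk φ (φ (gpOf K G i y) * p)) ⟨⟨i, y⟩, h.1, h.2.1, h.2.2, rfl⟩ else 1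
        obtain ⟨η, hη, hηlab⟩ := (hL X).1 lab
        obtain ⟨c, hc, hcη⟩ := hη.exists_isCocycle hφ
        let F : ActionObj φ ⥤ SingleObj X :=
          { obj := fun _ => SingleObj.star X
            map := fun {p _} g => c (label g) p.val
            map_id := fun p => hc.map_one p.val
            map_comp := by
              intro p q r g g'
              change c (label g' * label g) p.val = c (label g') q.val * c (label g) p.val
              rw [hc, label_spec] }
        refine ⟨F, ?_, ?_⟩
        · rintro p q ⟨⟨i, y⟩, hy, hp, hpL, hpq⟩
          change φ (gpOf K G i y) * val p = q at hpq
          subst hpq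
          exact (hcη i y (val p)).trans ((hηlab i (Finset.mem_univ i) y hy (val p) hp hpL).trans
            (dif_pos ⟨hy, hp, hpL⟩))
        · intro E hE
          let c' : GraphProduct m K G → (∀ i, G i) → X := fun g p =>
            E.map (homMk g rfl : mk φ p ⟶ mk φ (φ g * p))
          have hEc : ∀ {p q : ActionObj φ} (g : p ⟶ q), E.map g = c' (label g) p.val := by
            rintro p q ⟨g, hg⟩
            change φ g * p.val = q at hg
            subst hg
            rfl
          have hc' : IsCocycle φ c' := by
            intro g h p
            have := E.map_comp (homMk h rfl : mk φ p ⟶ mk φ (φ h * p))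
              (homMk g rfl : mk φ (φ h * p) ⟶ mk φ (φ g * (φ h * p)))
            rw [hEc] at this
            exact this
          have hηc' : ∀ i ∈ Finset.univ, η i = fun x => c' (gpOf K G i x) := by
            refine (hL X).2 η _ hη (hc'.isCompatibleFamily hφ) ?_
            intro i hi y hy p hp hpL
            rw [hηlab i hi y hy p hp hpL]
            refine (dif_pos ⟨hy, hp, hpL⟩).trans ?_
            exact (hE _ _ _).symm
          have hcc' : c' = c := hc'.ext hc fun i x p => by
            rw [hcη, hηc' i (Finset.mem_univ i)]
          refine Functor.hext (fun _ => rfl) fun p q g => heq_of_eq ?_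
          rw [hEc, hcc'] }
  have := isConnected (surjective_of_gpOf_eq_mulSingle hφ)
  have hfree : IsFreeGroup (End (mk φ 1)) := IsFreeGroupoid.endIsFreeOfConnectedFree (mk φ 1)
  exact IsFreeGroup.ofMulEquiv endEquivKer

end Chordal

section NonChordal

theorem IsCocycle.exists_lift {ι : Type*} {G : ι → Type*} [∀ i, Group (G i)] {A : Type*} [Group A]
    {φ : A →* ∀ i, G i} [IsFreeGroup φ.ker] (hφ : Function.Surjective φ) {E Q : Type*} [Group E]
    [Group Q] (π : E →* Q) (hπ : Function.Surjective π) {c : A → (∀ i, G i) → Q}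
    (hc : ∀ g h p, c (g * h) p = c g (φ h * p) * c h p) :
    ∃ c' : A → (∀ i, G i) → E, (∀ g h p, c' (g * h) p = c' g (φ h * p) * c' h p) ∧
      ∀ g p, π (c' g p) = c g p := by
  choose σ hσ using hφ
  choose τ hτ using hπ
  let α : φ.ker →* Q := MonoidHom.mk' (fun x => c x 1) fun x y => by
    rw [Subgroup.coe_mul, hc, y.2, one_mul]
  let α' : φ.ker →* E := IsFreeGroup.lift fun a => τ (α (IsFreeGroup.of a))
  have hα' : ∀ x, π (α' x) = α x := by
    have : π.comp α' = α := IsFreeGroup.ext_hom fun a => by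
      rw [MonoidHom.comp_apply, IsFreeGroup.lift_of, hτ]
    exact fun x => DFunLike.congr_fun this x
  let κ : A → (∀ i, G i) → φ.ker := fun g p =>
    ⟨(σ (φ g * p))⁻¹ * g * σ p, by simp [MonoidHom.mem_ker, hσ]⟩
  have hκ : ∀ g h p, κ (g * h) p = κ g (φ h * p) * κ h p := fun g h p =>
    Subtype.ext (by simp [κ, mul_assoc])
  refine ⟨fun g p => τ (c (σ (φ g * p)) 1) * α' (κ g p) * (τ (c (σ p) 1))⁻¹, ?_, ?_⟩
  · intro g h p
    simp only [hκ, map_mul, mul_assoc, inv_mul_cancel_left]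
  · intro g p
    have h1 : c (σ (φ g * p) * κ g p) 1 = c (σ (φ g * p)) 1 * α (κ g p) := by
      rw [hc, (κ g p).2, one_mul]
      rfl
    have h2 : σ (φ g * p) * κ g p = g * σ p := by simp [κ, mul_assoc]
    rw [h2, hc, hσ, mul_one] at h1
    rw [map_mul, map_mul, map_inv, hτ, hτ, hα', ← h1, mul_inv_cancel_right]

/-- The integral Heisenberg group. -/
@[ext]
structure IntHeisenberg where
  /-- The first coordinate of the abelianization. -/
  x : ℤ
  /-- The second coordinate of the abelianization. -/
  y : ℤ
  /-- The central coordinate. -/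
  z : ℤ

namespace IntHeisenberg

instance : Mul IntHeisenberg := ⟨fun a b => ⟨a.x + b.x, a.y + b.y, a.z + b.z + a.x * b.y⟩⟩

instance : One IntHeisenberg := ⟨⟨0, 0, 0⟩⟩

instance : Inv IntHeisenberg := ⟨fun a => ⟨-a.x, -a.y, -a.z + a.x * a.y⟩⟩

theorem mul_def (a b : IntHeisenberg) :
    a * b = ⟨a.x + b.x, a.y + b.y, a.z + b.z + a.x * b.y⟩ := rfl

theorem one_def : (1 : IntHeisenberg) = ⟨0, 0, 0⟩ := rfl

theorem inv_def (a : IntHeisenberg) : a⁻¹ = ⟨-a.x, -a.y, -a.z + a.x * a.y⟩ := rfl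

instance : Group IntHeisenberg :=
  Group.ofLeftAxioms (fun a b c => by simp only [mul_def, mk.injEq]; refine ⟨?_, ?_, ?_⟩ <;> ring)
    (fun a => by simp [mul_def, one_def]) (fun a => by simp [mul_def, one_def, inv_def])

/-- The abelianization of the Heisenberg group. -/
def toProd : IntHeisenberg →* Multiplicative (ℤ × ℤ) where
  toFun a := Multiplicative.ofAdd (a.x, a.y)
  map_one' := rfl
  map_mul' _ _ := rfl

theorem toProd_surjective : Function.Surjective toProd := fun q =>
  ⟨⟨q.toAdd.1, q.toAdd.2, 0⟩, rfl⟩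

end IntHeisenberg

theorem isCompatibleFamily_of_forall_adj {V : Type*} [DecidableEq V] {G : V → Type*}
    [∀ i, Group (G i)] (Γ : SimpleGraph V) (S : Finset V) {X : Type*} [CommGroup X]
    (f : V → (∀ i, G i) → X)
    (hf : ∀ i j, Γ.Adj i j → ∀ (y : G j) p, f i (Pi.mulSingle j y * p) = f i p) :
    IsCompatibleFamily Γ S fun i x p => f i (Pi.mulSingle i x * p) / f i p where
  map_mul i _ x y p := by rw [Pi.mulSingle_mul, mul_assoc, div_mul_div_cancel]
  comm i _ j _ hij x y p := by
    rw [← mul_assoc, (Pi.mulSingle_commute hij.ne x y).eq, mul_assoc, hf i j hij, hf i j hij,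
      ← mul_assoc, (Pi.mulSingle_commute hij.ne.symm y x).eq, mul_assoc, hf j i hij.symm,
      hf j i hij.symm, mul_comm]

/-- The signed sum of `γ` over the vertices of a cube, a coordinate of which is fixed. -/
theorem sum_powerset_erase_sub {V : Type*} [DecidableEq V] {P : Type*} (e : Finset V → P)
    (S : Finset V) {i j : V} (hij : i ≠ j) (hj : j ∈ S) (γ : P → ℤ) :
    ∑ s ∈ (S.erase i).powerset, (-1) ^ s.card * γ (e s) =
      -∑ s ∈ ((S.erase i).erase j).powerset, (-1) ^ s.card * (γ (e (insert j s)) - γ (e s)) := by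
  have hj' : j ∈ S.erase i := Finset.mem_erase.mpr ⟨hij.symm, hj⟩
  have h : S.erase i = insert j ((S.erase i).erase j) := (Finset.insert_erase hj').symm
  conv_lhs => rw [h]
  rw [Finset.sum_powerset_insert (Finset.notMem_erase _ _), ← Finset.sum_add_distrib,
    ← Finset.sum_neg_distrib]
  refine Finset.sum_congr rfl fun s hs => ?_
  rw [Finset.card_insert_of_notMem fun h => Finset.notMem_erase j _ (Finset.mem_powerset.mp hs h)]
  ring

variable {m : ℕ} {K : Finset (Finset (Fin m))} {G : Fin m → Type*} [∀ i, Group (G i)]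
  [∀ i, Nontrivial (G i)]

/-- If the kernel of the projection is free, then an edge lying on a cycle of the 1-skeleton forms
a triangle with some vertex of the cycle. -/
theorem exists_mem_support_adj_adj_of_isFreeGroup_ker (φ : GraphProduct m K G →* (∀ i, G i))
    (hφ : ∀ (i : Fin m) (g : G i), φ (gpOf K G i g) = Pi.mulSingle i g) [IsFreeGroup φ.ker]
    {u v : Fin m} (huv : (oneSkeleton m K).Adj u v) (w : (oneSkeleton m K).Walk v u)
    (hw : s(u, v) ∉ w.edges) :
    ∃ x ∈ w.support, (oneSkeleton m K).Adj u x ∧ (oneSkeleton m K).Adj v x := by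
  classical
  by_contra! hno
  let S : Finset (Fin m) := w.support.toFinset
  have huS : u ∈ S := List.mem_toFinset.mpr w.end_mem_support
  have hvS : v ∈ S := List.mem_toFinset.mpr w.start_mem_support
  -- the indicator function of the points that are trivial on the non-neighbours of `r` in `S`
  let f : Fin m → (∀ i, G i) → ℤ := fun r p =>
    if ∀ k ∈ S, ¬ (oneSkeleton m K).Adj r k → p k = 1 then 1 else 0
  have hf : ∀ r j, (oneSkeleton m K).Adj r j → ∀ (y : G j) p, f r (Pi.mulSingle j y * p) = f r p := by
    intro r j hrj y p
    refine if_congr (forall₂_congr fun k _ => forall_congr' fun hrk => ?_) rfl rfl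
    have hkj : k ≠ j := fun h => hrk (h ▸ hrj)
    rw [Pi.mul_apply, Pi.mulSingle_eq_of_ne hkj, one_mul]
  let F : Fin m → (∀ i, G i) → Multiplicative (ℤ × ℤ) := fun i p =>
    Multiplicative.ofAdd (if i = u then f u p else 0, if i = v then f v p else 0)
  have hF : ∀ i j, (oneSkeleton m K).Adj i j → ∀ (y : G j) p,
      F i (Pi.mulSingle j y * p) = F i p := by
    intro i j hij y p
    refine congrArg Multiplicative.ofAdd (Prod.ext ?_ ?_)
    · by_cases hi : i = u
      · subst hi; simp only [hf i j hij]
      · simp only [if_neg hi]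
    · by_cases hi : i = v
      · subst hi; simp only [hf i j hij]
      · simp only [if_neg hi]
  obtain ⟨c₀, hc₀, hc₀F⟩ :=
    (isCompatibleFamily_of_forall_adj (oneSkeleton m K) Finset.univ F hF).exists_isCocycle hφ
  obtain ⟨c, hc, hcc₀⟩ := IsCocycle.exists_lift (surjective_of_gpOf_eq_mulSingle hφ)
    IntHeisenberg.toProd IntHeisenberg.toProd_surjective hc₀
  have hcx : ∀ i x p, (c (gpOf K G i x) p).x =
      if i = u then f u (Pi.mulSingle i x * p) - f u p else 0 := by
    intro i x p
    have h := congrArg (fun q => q.toAdd.1) ((hcc₀ (gpOf K G i x) p).trans (hc₀F i x p))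
    refine h.trans ?_
    change (if i = u then f u (Pi.mulSingle i x * p) else 0) - (if i = u then f u p else 0) = _
    by_cases hi : i = u
    · simp only [if_pos hi]
    · simp only [if_neg hi, sub_zero]
  have hcy : ∀ i x p, (c (gpOf K G i x) p).y =
      if i = v then f v (Pi.mulSingle i x * p) - f v p else 0 := by
    intro i x p
    have h := congrArg (fun q => q.toAdd.2) ((hcc₀ (gpOf K G i x) p).trans (hc₀F i x p))
    refine h.trans ?_
    change (if i = v then f v (Pi.mulSingle i x * p) else 0) - (if i = v then f v p else 0) = _
    by_cases hi : i = v
    · simp only [if_pos hi]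
    · simp only [if_neg hi, sub_zero]
  choose a ha using fun i => exists_ne (1 : G i)
  let γ : Fin m → (∀ i, G i) → ℤ := fun i p => (c (gpOf K G i (a i)) p).z
  let e : Finset (Fin m) → (∀ i, G i) := fun s k => if k ∈ s then a k else 1
  have he : ∀ s j, j ∉ s → e (insert j s) = Pi.mulSingle j (a j) * e s := by
    intro s j hj
    funext k
    by_cases hk : k = j
    · subst hk
      simp [e, hj]
    · simp [e, hk]
  have hcomm : ∀ i j, (oneSkeleton m K).Adj i j → ∀ p,
      γ i (Pi.mulSingle j (a j) * p) - γ i p +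
          (c (gpOf K G i (a i)) (Pi.mulSingle j (a j) * p)).x * (c (gpOf K G j (a j)) p).y =
        γ j (Pi.mulSingle i (a i) * p) - γ j p +
          (c (gpOf K G j (a j)) (Pi.mulSingle i (a i) * p)).x * (c (gpOf K G i (a i)) p).y := by
    intro i j hij p
    have h1 := hc (gpOf K G i (a i)) (gpOf K G j (a j)) p
    rw [gpOf_comm hij, hc, hφ, hφ] at h1
    have h2 := congrArg IntHeisenberg.z h1
    simp only [IntHeisenberg.mul_def] at h2
    simp only [γ]
    linarith
  let T : Fin m → ℤ := fun i => ∑ s ∈ (S.erase i).powerset, (-1) ^ s.card * γ i (e s)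
  have hT : ∀ i j, (oneSkeleton m K).Adj i j → j ∈ S → T i =
      -∑ s ∈ ((S.erase i).erase j).powerset,
        (-1) ^ s.card * (γ i (Pi.mulSingle j (a j) * e s) - γ i (e s)) := by
    intro i j hij hj
    refine (sum_powerset_erase_sub e S hij.ne hj (γ i)).trans (congrArg Neg.neg ?_)
    refine Finset.sum_congr rfl fun s hs => ?_
    rw [he s j fun h => Finset.notMem_erase j _ (Finset.mem_powerset.mp hs h)]
  have hTeq : ∀ i j, (oneSkeleton m K).Adj i j → i ∈ S → j ∈ S → s(i, j) ≠ s(u, v) →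
      T i = T j := by
    intro i j hij hi hj hne
    rw [hT i j hij hj, hT j i hij.symm hi, Finset.erase_right_comm]
    refine congrArg Neg.neg (Finset.sum_congr rfl fun s _ => congrArg _ ?_)
    have h := hcomm i j hij (e s)
    have h1 : (c (gpOf K G i (a i)) (Pi.mulSingle j (a j) * e s)).x *
        (c (gpOf K G j (a j)) (e s)).y = 0 := by
      by_cases hiu : i = u
      · by_cases hjv : j = v
        · exact absurd (by rw [hiu, hjv]) hne
        · rw [hcy, if_neg hjv, mul_zero]
      · rw [hcx, if_neg hiu, zero_mul]
    have h2 : (c (gpOf K G j (a j)) (Pi.mulSingle i (a i) * e s)).x *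
        (c (gpOf K G i (a i)) (e s)).y = 0 := by
      by_cases hju : j = u
      · by_cases hiv : i = v
        · exact absurd (by rw [hju, hiv, Sym2.eq_swap]) hne
        · rw [hcy, if_neg hiv, mul_zero]
      · rw [hcx, if_neg hju, zero_mul]
    rwa [h1, h2, add_zero, add_zero] at h
  have hwalk : ∀ {b d : Fin m} (q : (oneSkeleton m K).Walk b d), (∀ x ∈ q.support, x ∈ S) →
      s(u, v) ∉ q.edges → T b = T d := by
    intro b d q
    induction q with
    | nil => exact fun _ _ => rfl
    | cons hbk q ih =>
      intro hS hq
      rw [SimpleGraph.Walk.edges_cons, List.mem_cons, not_or] at hq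
      rw [SimpleGraph.Walk.support_cons] at hS
      rw [hTeq _ _ hbk (hS _ List.mem_cons_self)
        (hS _ (List.mem_cons_of_mem _ q.start_mem_support)) (Ne.symm hq.1)]
      exact ih (fun x hx => hS x (List.mem_cons_of_mem _ hx)) hq.2
  have hTvu : T v = T u := hwalk w (fun x hx => List.mem_toFinset.mpr hx) hw
  have hprod : ∀ s ∈ ((S.erase u).erase v).powerset,
      (c (gpOf K G u (a u)) (Pi.mulSingle v (a v) * e s)).x * (c (gpOf K G v (a v)) (e s)).y =
        if s = ∅ then 1 else 0 := by
    intro s hs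
    rw [Finset.mem_powerset] at hs
    have hus : u ∉ s := fun h => by simpa using hs h
    have hvs : v ∉ s := fun h => by simpa using hs h
    rw [hcx, hcy, if_pos rfl, if_pos rfl, hf u v huv]
    have hz : ∀ r ∈ S, r ∉ s → f r (Pi.mulSingle r (a r) * e s) = 0 := by
      intro r hr hrs
      refine if_neg fun h => ha r ?_
      simpa [e, hrs] using h r hr ((oneSkeleton m K).loopless.irrefl r)
    have hfs : ∀ r, f r (e s) = if ∀ k ∈ s, (oneSkeleton m K).Adj r k then 1 else 0 := by
      intro r
      refine if_congr ⟨fun h k hk => ?_, fun h k _ hrk => ?_⟩ rfl rfl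
      · by_contra hrk
        have := h k (Finset.mem_of_mem_erase (Finset.mem_of_mem_erase (hs hk))) hrk
        simp only [e, if_pos hk] at this
        exact ha k this
      · exact if_neg fun hk => hrk (h k hk)
    rw [← mul_assoc, (Pi.mulSingle_commute huv.ne (a u) (a v)).eq, mul_assoc, hf u v huv,
      hz u huS hus, hz v hvS hvs, hfs, hfs, zero_sub, zero_sub, neg_mul_neg, ite_zero_mul_ite_zero, one_mul]
    refine if_congr ⟨fun h => ?_, fun h => ?_⟩ rfl rfl
    · refine Finset.eq_empty_of_forall_notMem fun k hk => ?_
      exact hno k (List.mem_toFinset.mp (Finset.mem_of_mem_erase (Finset.mem_of_mem_erase (hs hk))))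
        (h.1 k hk) (h.2 k hk)
    · subst h
      simp
  have hdiff : T u - T v = 1 := by
    rw [hT u v huv hvS, hT v u huv.symm huS, Finset.erase_right_comm (a := v), neg_sub_neg,
      ← Finset.sum_sub_distrib]
    calc _ = ∑ s ∈ ((S.erase u).erase v).powerset, if s = ∅ then (1 : ℤ) else 0 := by
          refine Finset.sum_congr rfl fun s hs => ?_
          have h := hcomm u v huv (e s)
          rw [hprod s hs, hcx v, if_neg huv.ne.symm, zero_mul, add_zero] at h
          rw [← mul_sub, ← h, add_sub_cancel_left]
          split_ifs with hs0
          · rw [hs0, Finset.card_empty, pow_zero, one_mul]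
          · exact mul_zero _
      _ = 1 := by
          rw [Finset.sum_ite_eq', if_pos (Finset.empty_mem_powerset _)]
  rw [hTvu, sub_self] at hdiff
  exact zero_ne_one hdiff

theorem isChordal_of_isFreeGroup_ker (φ : GraphProduct m K G →* (∀ i, G i))
    (hφ : ∀ (i : Fin m) (g : G i), φ (gpOf K G i g) = Pi.mulSingle i g) [IsFreeGroup φ.ker] :
    IsChordal (oneSkeleton m K) := by
  intro u c hc hlen
  by_contra! hchord
  cases c with
  | nil => simp at hlen
  | @cons _ v _ huv p =>
    obtain ⟨hp, hep⟩ := (SimpleGraph.Walk.cons_isCycle_iff p huv).mp hc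
    obtain ⟨x, hx, hux, hvx⟩ := exists_mem_support_adj_adj_of_isFreeGroup_ker φ hφ huv p hep
    have mem_edges : ∀ y ∈ p.support, (oneSkeleton m K).Adj y x → s(y, x) ≠ s(u, v) →
        s(y, x) ∈ p.edges := by
      intro y hy hyx hne
      have h := hchord y x (by simp [hy]) (by simp [hx]) hyx
      rw [SimpleGraph.Walk.edges_cons, List.mem_cons] at h
      exact h.resolve_left hne
    have hux' := mem_edges u p.end_mem_support hux fun h => hvx.ne (Sym2.congr_right.mp h).symm
    have hvx' := mem_edges v p.start_mem_support hvx fun h =>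
      hux.ne (Sym2.congr_right.mp (h.trans Sym2.eq_swap)).symm
    cases p with
    | nil => exact huv.ne rfl
    | @cons _ w _ hvw q =>
      have hw := hp.eq_snd_of_mem_edges hvx'
      rw [SimpleGraph.Walk.snd_cons] at hw
      subst hw
      rw [SimpleGraph.Walk.edges_cons, List.mem_cons] at hux'
      have hq := ((SimpleGraph.Walk.cons_isPath_iff _ _).mp hp).1.length_eq_one_of_mem_edges
        (Sym2.eq_swap ▸ hux'.resolve_left fun h => huv.ne (Sym2.congr_left.mp h))
      simp only [SimpleGraph.Walk.length_cons, hq] at hlen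
      omega

end NonChordal

/-- For a flag simplicial complex `K` on `m` vertices, nontrivial groups `G₁, …, G_m`, and the
canonical projection `φ : G^K → G₁ × ⋯ × G_m` (which restricts to the identity on each `G_k`),
the kernel of `φ` is a free group if and only if the 1-skeleton of `K` is a chordal graph. -/
theorem graph_product_kernel_free_iff_chordal (m : ℕ) (K : Finset (Finset (Fin m)))
    (hdown : ∀ I ∈ K, ∀ J ⊆ I, J ∈ K) (hempty : (∅ : Finset (Fin m)) ∈ K)
    (hsingle : ∀ i : Fin m, ({i} : Finset (Fin m)) ∈ K)
    (hflag : ∀ J : Finset (Fin m),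
      (∀ i ∈ J, ∀ j ∈ J, i ≠ j → ({i, j} : Finset (Fin m)) ∈ K) → J ∈ K)
    (G : Fin m → Type) [∀ i, Group (G i)] [∀ i, Nontrivial (G i)]
    (φ : GraphProduct m K G →* (∀ i, G i))
    (hφ : ∀ (i : Fin m) (g : G i), φ (gpOf K G i g) = Pi.mulSingle i g) :
    IsFreeGroup φ.ker ↔ IsChordal (oneSkeleton m K) := by
  exact ⟨fun _ => isChordal_of_isFreeGroup_ker φ hφ, fun h => h.isFreeGroup_ker φ hφ⟩
end

section
/- Let K be a flag simplicial complex on the vertex set [m], let G_1, …, G_m be nontrivial groups, let G^K be their graph product over K, and let φ : G^K → G_1 × ⋯ × G_m be the canonical projection homomorphism. Consider the set S of all nested iterated commutators (g_{k_1}, (g_{k_2}, …, (g_{k_{ℓ-2}}, (g_j, g_i)) … )) in G^K, where 2 ≤ ℓ ≤ m, each g_k ranges over the nonidentity elements of the corresponding group G_k, the indices satisfy k_1 < … < k_{ℓ-2} < j, i < j, k_s ≠ i for all s, and, in the simple graph on the vertex set J = {k_1, …, k_{ℓ-2}, j, i} whose edges are the 2-element subsets of J that are faces of K, the vertex i lies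 in a connected component not containing j and i is the smallest vertex of its connected component. Then S is a minimal generating set of ker φ: the subgroup generated by S equals ker φ, and no proper subset of S generates ker φ. -/
/-- The simple graph on the vertex set `J ⊆ [m]` whose edges are the 2-element subsets of `J`
that are faces of `K` (other vertices of `[m]` are isolated). -/
def graphOn (m : ℕ) (K : Finset (Finset (Fin m))) (J : Finset (Fin m)) : SimpleGraph (Fin m) :=
  SimpleGraph.fromRel (fun a b => a ∈ J ∧ b ∈ J ∧ ({a, b} : Finset (Fin m)) ∈ K)

/-- The set `S` of basic nested iterated commutators
`(g_{k₁}, (g_{k₂}, …, (g_{k_{ℓ-2}}, (g_j, g_i))…))` in the graph product `G^K`, where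
`2 ≤ ℓ ≤ m`, each `g_k` is a nonidentity element of `G_k`, `k₁ < ⋯ < k_{ℓ-2} < j`, `i < j`,
`kₛ ≠ i` for all `s`, and in the graph on `J = {k₁, …, k_{ℓ-2}, j, i}` whose edges are the
2-element subsets of `J` that are faces of `K`, the vertex `i` lies in a connected component
not containing `j` and `i` is the smallest vertex of its connected component. -/
def gpCommSet (m : ℕ) (K : Finset (Finset (Fin m))) (G : Fin m → Type*) [∀ i, Group (G i)] :
    Set (GraphProduct m K G) :=
  { x | ∃ (L : List ((k : Fin m) × G k)) (j i : Fin m) (gj : G j) (gi : G i),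
      List.Chain' (· < ·) (L.map Sigma.fst) ∧
      (∀ p ∈ L, p.1 < j) ∧
      i < j ∧
      (∀ p ∈ L, p.1 ≠ i) ∧
      (∀ p ∈ L, p.2 ≠ 1) ∧ gj ≠ 1 ∧ gi ≠ 1 ∧
      L.length + 2 ≤ m ∧
      ¬ (graphOn m K ((L.map Sigma.fst).toFinset ∪ {j, i})).Reachable i j ∧
      (∀ i' : Fin m,
        (graphOn m K ((L.map Sigma.fst).toFinset ∪ {j, i})).Reachable i i' → i ≤ i') ∧
      x = L.foldr (fun p w => pcomm (gpOf K G p.1 p.2) w)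
            (pcomm (gpOf K G j gj) (gpOf K G i gi)) }

namespace GraphProduct

open Function

section Elements

variable {m : ℕ} {K : Finset (Finset (Fin m))} {G : Fin m → Type*} [∀ i, Group (G i)]

@[simp] lemma gpOf_one (i : Fin m) : gpOf K G i 1 = 1 := by
  simp [gpOf]

lemma gpOf_mul (i : Fin m) (g h : G i) : gpOf K G i (g * h) = gpOf K G i g * gpOf K G i h := by
  simp [gpOf]

lemma gpOf_inv (i : Fin m) (g : G i) : gpOf K G i g⁻¹ = (gpOf K G i g)⁻¹ := by
  simp [gpOf]

lemma gpOf_comm {i j : Fin m} (hij : i ≠ j) (hK : ({i, j} : Finset (Fin m)) ∈ K)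
    (g : G i) (h : G j) :
    gpOf K G i g * gpOf K G j h = gpOf K G j h * gpOf K G i g := by
  have key : (QuotientGroup.mk ((Monoid.CoprodI.of g)⁻¹ * (Monoid.CoprodI.of h)⁻¹ *
      Monoid.CoprodI.of g * Monoid.CoprodI.of h) : GraphProduct m K G) = 1 :=
    (QuotientGroup.eq_one_iff _).2 <|
      Subgroup.subset_normalClosure ⟨i, j, g, h, hij, hK, rfl⟩
  change (gpOf K G i g)⁻¹ * (gpOf K G j h)⁻¹ * gpOf K G i g * gpOf K G j h = 1 at key
  rw [mul_assoc, ← mul_inv_rev, inv_mul_eq_one] at key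
  exact key.symm

lemma graphOn_adj {J : Finset (Fin m)} {a b : Fin m} :
    (graphOn m K J).Adj a b ↔ a ≠ b ∧ a ∈ J ∧ b ∈ J ∧ ({a, b} : Finset (Fin m)) ∈ K := by
  simp only [graphOn, SimpleGraph.fromRel_adj, Finset.pair_comm b a]
  tauto

lemma graphOn_mono {J J' : Finset (Fin m)} (h : J ⊆ J') : graphOn m K J ≤ graphOn m K J' := by
  intro a b hab
  rw [graphOn_adj] at hab ⊢
  exact ⟨hab.1, h hab.2.1, h hab.2.2.1, hab.2.2.2⟩

lemma mem_of_reachable {J : Finset (Fin m)} {a b : Fin m} (ha : a ∈ J)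
    (h : (graphOn m K J).Reachable a b) : b ∈ J := by
  rw [SimpleGraph.reachable_iff_reflTransGen] at h
  cases h with
  | refl => exact ha
  | tail _ hbc => exact (graphOn_adj.1 hbc).2.2.1

/-- The nested commutator `(g₁, (g₂, …, (gᵣ, w)…))` along a list of group elements. -/
def nested (K : Finset (Finset (Fin m))) (L : List ((k : Fin m) × G k)) (w : GraphProduct m K G) :
    GraphProduct m K G :=
  L.foldr (fun p w => pcomm (gpOf K G p.1 p.2) w) w

/-- The product `g₁⁻¹ ⋯ gᵣ⁻¹` along a list of group elements. -/
def invProd (K : Finset (Finset (Fin m))) (L : List ((k : Fin m) × G k)) : GraphProduct m K G :=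
  (L.map fun p => (gpOf K G p.1 p.2)⁻¹).prod

lemma invProd_conj_mem (H : Subgroup (GraphProduct m K G)) (c : GraphProduct m K G)
    (A : List ((k : Fin m) × G k)) :
    ∀ B, (∀ A', A'.Sublist A → nested K (A' ++ B) c ∈ H) →
      invProd K A * nested K B c * (invProd K A)⁻¹ ∈ H := by
  induction A using List.reverseRecOn with
  | nil => intro B h; simpa [invProd] using h [] (List.Sublist.refl _)
  | append_singleton A a ih =>
    intro B h
    have h1 := ih B fun A' hA' => h A' (hA'.trans (List.sublist_append_left _ _))
    have h2 := ih (a :: B) fun A' hA' => by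
      simpa using h (A' ++ [a]) (hA'.append (List.Sublist.refl _))
    have e : invProd K (A ++ [a]) * nested K B c * (invProd K (A ++ [a]))⁻¹ =
        (invProd K A * nested K B c * (invProd K A)⁻¹) *
          (invProd K A * nested K (a :: B) c * (invProd K A)⁻¹)⁻¹ := by
      have e1 : nested K (a :: B) c = pcomm (gpOf K G a.1 a.2) (nested K B c) := rfl
      have e2 : invProd K (A ++ [a]) = invProd K A * (gpOf K G a.1 a.2)⁻¹ := by
        simp [invProd]
      rw [e1, e2, pcomm]
      group
    rw [e]
    exact H.mul_mem h1 (H.inv_mem h2)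

/-- The product of the coordinates of `u` in increasing order of the vertices. -/
def ordProd (K : Finset (Finset (Fin m))) (u : ∀ k, G k) : GraphProduct m K G :=
  ((List.finRange m).map fun k => gpOf K G k (u k)).prod

lemma ordProd_eq_mul {u : ∀ k, G k} {j : Fin m} (hj : ∀ k, j < k → u k = 1) :
    ordProd K u = ordProd K (update u j 1) * gpOf K G j (u j) := by
  have key : ∀ l : List (Fin m), l.Pairwise (· < ·) → j ∈ l →
      (l.map fun k => gpOf K G k (u k)).prod =
        (l.map fun k => gpOf K G k (update u j 1 k)).prod * gpOf K G j (u j) := by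
    intro l
    induction l with
    | nil => simp
    | cons a l ih =>
      intro hl hjl
      rw [List.pairwise_cons] at hl
      rcases eq_or_ne a j with rfl | haj
      · have h1 : ∀ k ∈ l, gpOf K G k (u k) = 1 := fun k hk => by rw [hj k (hl.1 k hk), gpOf_one]
        have h2 : ∀ k ∈ l, gpOf K G k (update u a 1 k) = 1 := fun k hk => by
          rw [update_of_ne (hl.1 k hk).ne', h1 k hk]
        rw [List.map_cons, List.map_cons, List.map_congr_left h1, List.map_congr_left h2]
        simp
      · have hjl' : j ∈ l := (List.mem_cons.1 hjl).resolve_left haj.symm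
        rw [List.map_cons, List.map_cons, List.prod_cons, List.prod_cons, ih hl.2 hjl',
          update_of_ne haj, mul_assoc]
  exact key _ (List.pairwise_lt_finRange m) (List.mem_finRange j)

open Classical in
lemma ordProd_eq_invProd (u : ∀ k, G k) :
    ordProd K u =
      invProd K (((List.finRange m).filter fun k => u k ≠ 1).map fun k => ⟨k, (u k)⁻¹⟩) := by
  unfold ordProd invProd
  induction List.finRange m with
  | nil => simp
  | cons a l ih =>
    by_cases h : u a = 1
    · simpa [h] using ih
    · rw [List.map_cons, List.prod_cons, ih]
      simp [h, gpOf_inv]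

end Elements

section Generation

variable {m : ℕ} {K : Finset (Finset (Fin m))} {G : Fin m → Type*} [∀ i, Group (G i)]

open Classical in
/-- The set of vertices at which `u` is nontrivial. -/
noncomputable def supp (u : ∀ k, G k) : Finset (Fin m) := Finset.univ.filter fun k => u k ≠ 1

@[simp] lemma mem_supp {u : ∀ k, G k} {k : Fin m} : k ∈ supp u ↔ u k ≠ 1 := by
  simp [supp]

lemma supp_update_one_ssubset {u : ∀ k, G k} {i : Fin m} (hi : u i ≠ 1) :
    supp (update u i 1) ⊂ supp u := by
  rw [Finset.ssubset_iff_of_subset]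
  · exact ⟨i, by simpa using hi, by simp⟩
  · intro k hk
    rcases eq_or_ne k i with rfl | h
    · simp at hk
    · simpa [update_of_ne h] using hk

/-- Two elements lie in the same right coset of the subgroup generated by `gpCommSet`. -/
def SameCoset (x y : GraphProduct m K G) : Prop :=
  x * y⁻¹ ∈ Subgroup.closure (gpCommSet m K G)

namespace SameCoset

variable {x y z : GraphProduct m K G}

lemma of_eq (h : x = y) : SameCoset x y := by
  simp [SameCoset, h]

lemma symm (h : SameCoset x y) : SameCoset y x := by
  simpa [SameCoset] using Subgroup.inv_mem _ h

lemma trans (h : SameCoset x y) (h' : SameCoset y z) : SameCoset x z := by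
  simpa [SameCoset] using Subgroup.mul_mem _ h h'

lemma mul_right (h : SameCoset x y) (z : GraphProduct m K G) : SameCoset (x * z) (y * z) := by
  simpa [SameCoset, mul_assoc] using h

end SameCoset

open Classical in
lemma ordProd_conj_mem {u : ∀ k, G k} {i j : Fin m} (hi : u i ≠ 1) (hj : u j ≠ 1)
    (hmax : ∀ k ∈ supp u, k ≤ j) (hij : ¬ (graphOn m K (supp u)).Reachable i j)
    (hmin : ∀ k, (graphOn m K (supp u)).Reachable i k → i ≤ k) :
    ordProd K (update (update u j 1) i 1) * pcomm (gpOf K G j (u j)⁻¹) (gpOf K G i (u i)⁻¹) *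
      (ordProd K (update (update u j 1) i 1))⁻¹ ∈ Subgroup.closure (gpCommSet m K G) := by
  have hne : i ≠ j := by rintro rfl; exact hij (SimpleGraph.Reachable.refl _)
  rw [ordProd_eq_invProd]
  set w := update (update u j 1) i 1 with hw
  have hwk : ∀ k, w k ≠ 1 → k ≠ i ∧ k ≠ j ∧ u k ≠ 1 := by
    intro k hk
    have h1 : k ≠ i := by rintro rfl; simp [hw] at hk
    have h2 : k ≠ j := by rintro rfl; simp [hw, update_of_ne h1] at hk
    exact ⟨h1, h2, by simpa [hw, update_of_ne h1, update_of_ne h2] using hk⟩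
  refine invProd_conj_mem _ _ _ [] fun A hA => Subgroup.subset_closure ?_
  have hmem : ∀ p ∈ A, p.1 ≠ i ∧ p.1 ≠ j ∧ u p.1 ≠ 1 ∧ p.2 ≠ 1 := by
    intro p hp
    obtain ⟨k, hk, rfl⟩ := List.mem_map.1 (hA.subset hp)
    have hk' : w k ≠ 1 := by simpa using (List.mem_filter.1 hk).2
    exact ⟨(hwk k hk').1, (hwk k hk').2.1, (hwk k hk').2.2, inv_ne_one.2 hk'⟩
  have hpw : (A.map Sigma.fst).Pairwise (· < ·) := by
    refine List.Pairwise.sublist (hA.map _) ?_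
    rw [List.map_map]
    simpa [Function.comp_def] using (List.pairwise_lt_finRange m).filter _
  have hsub : (A.map Sigma.fst).toFinset ∪ {j, i} ⊆ supp u := by
    intro k hk
    simp only [Finset.mem_union, List.mem_toFinset, List.mem_map, Finset.mem_insert,
      Finset.mem_singleton] at hk
    rcases hk with ⟨p, hp, rfl⟩ | rfl | rfl
    · simpa using (hmem p hp).2.2.1
    · simpa using hj
    · simpa using hi
  refine ⟨A, j, i, (u j)⁻¹, (u i)⁻¹, hpw.isChain, ?_, ?_, fun p hp => (hmem p hp).1,
    fun p hp => (hmem p hp).2.2.2, inv_ne_one.2 hj, inv_ne_one.2 hi, ?_, ?_, ?_, ?_⟩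
  · exact fun p hp => lt_of_le_of_ne (hmax _ (by simpa using (hmem p hp).2.2.1)) (hmem p hp).2.1
  · exact lt_of_le_of_ne (hmax _ (by simpa using hi)) hne
  · have hnd : (j :: i :: A.map Sigma.fst).Nodup := by
      simp only [List.nodup_cons, List.mem_cons, List.mem_map, not_or, not_exists, not_and]
      exact ⟨⟨hne.symm, fun p hp => (hmem p hp).2.1⟩, fun p hp => (hmem p hp).1, hpw.nodup⟩
    have hlen := hnd.length_le_card
    simp only [List.length_cons, List.length_map, Fintype.card_fin] at hlen
    omega
  · exact fun h => hij (h.mono (graphOn_mono hsub))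
  · exact fun k h => hmin k (h.mono (graphOn_mono hsub))
  · rw [List.append_nil]
    rfl

lemma sameCoset_update_mul (u : ∀ k, G k) (i : Fin m) :
    SameCoset (ordProd K (update u i 1) * gpOf K G i (u i)) (ordProd K u) := by
  induction hn : (supp u).card using Nat.strong_induction_on generalizing u i with
  | _ n ih =>
  subst hn
  by_cases hi : u i = 1
  · rw [hi, gpOf_one, mul_one]
    exact .of_eq (by rw [update_eq_self_iff.2 hi.symm])
  have ih' : ∀ a, u a ≠ 1 → ∀ b, b ≠ a →
      SameCoset (ordProd K (update (update u a 1) b 1) * gpOf K G b (u b))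
        (ordProd K (update u a 1)) := by
    intro a ha b hb
    simpa [update_of_ne hb] using
      ih _ (Finset.card_lt_card (supp_update_one_ssubset ha)) (update u a 1) b rfl
  have hadj : ∀ a b, (graphOn m K (supp u)).Adj a b →
      SameCoset (ordProd K (update u a 1) * gpOf K G a (u a))
        (ordProd K (update u b 1) * gpOf K G b (u b)) := by
    intro a b hab
    obtain ⟨hne, ha, hb, hK⟩ := graphOn_adj.1 hab
    rw [mem_supp] at ha hb
    refine (((ih' a ha b hne.symm).mul_right _).symm.trans (.of_eq ?_)).trans
      ((ih' b hb a hne).mul_right _)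
    rw [mul_assoc, mul_assoc, gpOf_comm hne hK, update_comm hne]
  have hreach : ∀ a b, (graphOn m K (supp u)).Reachable a b →
      SameCoset (ordProd K (update u a 1) * gpOf K G a (u a))
        (ordProd K (update u b 1) * gpOf K G b (u b)) := by
    intro a b hab
    rw [SimpleGraph.reachable_iff_reflTransGen] at hab
    induction hab with
    | refl => exact .of_eq rfl
    | tail _ h ih => exact ih.trans (hadj _ _ h)
  have hne : (supp u).Nonempty := ⟨i, by simpa using hi⟩
  set j := (supp u).max' hne with hjdef
  have hj : u j ≠ 1 := by simpa using (supp u).max'_mem hne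
  have hmax : ∀ k ∈ supp u, k ≤ j := fun k hk => Finset.le_max' _ _ hk
  have hgt : ∀ k, j < k → u k = 1 := fun k hk => by
    by_contra h
    exact absurd (hmax k (by simpa using h)) (not_le.2 hk)
  by_cases hij : (graphOn m K (supp u)).Reachable i j
  · exact (hreach i j hij).trans (.of_eq (ordProd_eq_mul hgt).symm)
  classical
  have hcne : (Finset.univ.filter ((graphOn m K (supp u)).Reachable i)).Nonempty :=
    ⟨i, by simp⟩
  obtain ⟨i₀, hi₀, hmin⟩ := Finset.exists_min_image _ id hcne
  simp only [Finset.mem_filter, Finset.mem_univ, true_and, id] at hi₀ hmin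
  refine (hreach i i₀ hi₀).trans ?_
  have hu₀ : u i₀ ≠ 1 := by simpa using mem_of_reachable (by simpa using hi) hi₀
  have hne₀ : i₀ ≠ j := by rintro rfl; exact hij hi₀
  have hc := ordProd_conj_mem (K := K) hu₀ hj hmax (fun h => hij (hi₀.trans h))
    (fun k h => hmin k (hi₀.trans h))
  set x := ordProd K (update (update u j 1) i₀ 1) with hx
  have e1 : ordProd K (update u i₀ 1) = x * gpOf K G j (u j) := by
    rw [ordProd_eq_mul (u := update u i₀ 1) (j := j), update_comm hne₀, update_of_ne hne₀.symm]
    intro k hk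
    rcases eq_or_ne k i₀ with rfl | h
    · simp
    · rw [update_of_ne h, hgt k hk]
  rw [e1]
  have h1 : SameCoset (x * gpOf K G j (u j) * gpOf K G i₀ (u i₀))
      (x * gpOf K G i₀ (u i₀) * gpOf K G j (u j)) := by
    unfold SameCoset
    convert hc using 1
    rw [gpOf_inv, gpOf_inv, pcomm]
    group
  refine h1.trans (((ih' j hj i₀ hne₀).mul_right _).trans (.of_eq ?_))
  rw [← ordProd_eq_mul hgt]

lemma sameCoset_ordProd_mul (φ : GraphProduct m K G →* (∀ i, G i))
    (hφ : ∀ (i : Fin m) (g : G i), φ (gpOf K G i g) = Pi.mulSingle i g)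
    (x : GraphProduct m K G) (p : ∀ k, G k) :
    SameCoset (ordProd K p * x) (ordProd K (p * φ x)) := by
  induction x using QuotientGroup.induction_on with
  | H z =>
  induction z using Monoid.CoprodI.induction_on generalizing p with
  | one => exact .of_eq (by simp)
  | of i g =>
    change SameCoset (ordProd K p * gpOf K G i g) (ordProd K (p * φ (gpOf K G i g)))
    rw [hφ]
    have h1 := (sameCoset_update_mul (K := K) p i).symm.mul_right (gpOf K G i g)
    have h2 := sameCoset_update_mul (K := K) (p * Pi.mulSingle i g) i
    have e : update (p * Pi.mulSingle i g) i 1 = update p i 1 := by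
      ext k
      rcases eq_or_ne k i with rfl | h
      · simp
      · simp [h]
    rw [e, Pi.mul_apply, Pi.mulSingle_eq_same, gpOf_mul, ← mul_assoc] at h2
    exact h1.trans h2
  | mul a b ha hb =>
    rw [QuotientGroup.mk_mul, ← mul_assoc, map_mul, ← mul_assoc]
    exact ((ha p).mul_right _).trans (hb _)

lemma ker_le_closure (φ : GraphProduct m K G →* (∀ i, G i))
    (hφ : ∀ (i : Fin m) (g : G i), φ (gpOf K G i g) = Pi.mulSingle i g) :
    φ.ker ≤ Subgroup.closure (gpCommSet m K G) := by
  intro x hx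
  have h := sameCoset_ordProd_mul φ hφ x 1
  have h1 : ordProd K (1 : ∀ k, G k) = 1 := by simp [ordProd]
  rw [MonoidHom.mem_ker.1 hx, mul_one, h1] at h
  simpa [SameCoset] using h

lemma gpCommSet_subset_ker (φ : GraphProduct m K G →* (∀ i, G i))
    (hφ : ∀ (i : Fin m) (g : G i), φ (gpOf K G i g) = Pi.mulSingle i g) :
    gpCommSet m K G ⊆ φ.ker := by
  rintro x ⟨L, j, i, gj, gi, -, -, hij, -, -, -, -, -, -, -, rfl⟩
  rw [SetLike.mem_coe, MonoidHom.mem_ker]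
  induction L with
  | nil =>
    have hc : Pi.mulSingle j gj * Pi.mulSingle i gi = Pi.mulSingle i gi * Pi.mulSingle j gj :=
      Pi.mulSingle_commute hij.ne' gj gi
    simp only [List.foldr_nil, pcomm, map_mul, map_inv, hφ]
    rw [mul_assoc, ← mul_inv_rev, inv_mul_eq_one, hc]
  | cons a L ih =>
    rw [List.foldr_cons, pcomm, map_mul, map_mul, map_mul, map_inv, map_inv, ih]
    simp

end Generation

section Independence

variable {m : ℕ} {K : Finset (Finset (Fin m))} {G : Fin m → Type*} [∀ i, Group (G i)]

/-- The action of `Gᵢ` on `ℤ × ∏ Gₖ` by translations of the second factor, conjugated by the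
shear of the first factor along `F`. -/
def shearHom (F : (∀ k, G k) → ℤ) (i : Fin m) : G i →* Equiv.Perm (ℤ × ∀ k, G k) :=
  MonoidHom.toHomPerm
    { toFun := fun g x => (x.1 + (F (Pi.mulSingle i g * x.2) - F x.2), Pi.mulSingle i g * x.2)
      map_one' := by
        funext x
        change (_, _) = x
        simp
      map_mul' := fun g h => by
        funext x
        refine Prod.ext ?_ ?_
        · change _ = x.1 + (F (Pi.mulSingle i h * x.2) - F x.2) +
            (F (Pi.mulSingle i g * (Pi.mulSingle i h * x.2)) - F (Pi.mulSingle i h * x.2))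
          rw [Pi.mulSingle_mul, mul_assoc]
          ring
        · change _ = Pi.mulSingle i g * (Pi.mulSingle i h * x.2)
          rw [Pi.mulSingle_mul, mul_assoc] }

lemma shearHom_apply (F : (∀ k, G k) → ℤ) (i : Fin m) (g : G i) (a : ℤ) (p : ∀ k, G k) :
    shearHom F i g (a, p) =
      (a + (F (Pi.mulSingle i g * p) - F p), Pi.mulSingle i g * p) := rfl

/-- The homomorphism from the graph product given by a family of functions `F` satisfying the
compatibility condition along the edges of `K`. -/
def shearLift (K : Finset (Finset (Fin m))) (F : Fin m → (∀ k, G k) → ℤ)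
    (hF : ∀ (i j : Fin m) (g : G i) (h : G j), i ≠ j → ({i, j} : Finset (Fin m)) ∈ K →
      Commute (shearHom (F i) i g) (shearHom (F j) j h)) :
    GraphProduct m K G →* Equiv.Perm (ℤ × ∀ k, G k) :=
  QuotientGroup.lift _ (Monoid.CoprodI.lift fun i => shearHom (F i) i) <| by
    refine Subgroup.normalClosure_le_normal ?_
    rintro _ ⟨i, j, g, h, hij, hK, rfl⟩
    rw [SetLike.mem_coe, MonoidHom.mem_ker]
    simp only [map_mul, map_inv, Monoid.CoprodI.lift_of]
    rw [mul_assoc, ← mul_inv_rev, inv_mul_eq_one]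
    exact (hF i j g h hij hK).symm

lemma shearLift_gpOf (F : Fin m → (∀ k, G k) → ℤ) (hF) (i : Fin m) (g : G i) :
    shearLift K F hF (gpOf K G i g) = shearHom (F i) i g :=
  Monoid.CoprodI.lift_of (fi := fun i => shearHom (F i) i) g

lemma commute_shearHom {F F' : (∀ k, G k) → ℤ} {i j : Fin m} (hij : i ≠ j) (g : G i) (h : G j)
    (hFF : ∀ p, F (Pi.mulSingle i g * (Pi.mulSingle j h * p)) - F (Pi.mulSingle j h * p) -
        F (Pi.mulSingle i g * p) + F p =
      F' (Pi.mulSingle i g * (Pi.mulSingle j h * p)) - F' (Pi.mulSingle j h * p) -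
        F' (Pi.mulSingle i g * p) + F' p) :
    Commute (shearHom F i g) (shearHom F' j h) := by
  refine Equiv.ext fun ⟨a, p⟩ => ?_
  have hc : Pi.mulSingle j h * (Pi.mulSingle i g * p) =
      Pi.mulSingle i g * (Pi.mulSingle j h * p) :=
    (Pi.mulSingle_commute hij.symm h g).left_comm p
  simp only [Equiv.Perm.mul_apply, shearHom_apply, hc, Prod.mk.injEq, and_true]
  linarith [hFF p]

/-- The translation of the first factor of `ℤ × P` by a function of the second. -/
def fiberShift {P : Type*} (f : P → ℤ) : Equiv.Perm (ℤ × P) where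
  toFun x := (x.1 + f x.2, x.2)
  invFun x := (x.1 - f x.2, x.2)
  left_inv x := by simp
  right_inv x := by simp

lemma fiberShift_apply {P : Type*} (f : P → ℤ) (a : ℤ) (p : P) :
    fiberShift f (a, p) = (a + f p, p) := rfl

/-- The iterated difference of `f` along a list of group elements. -/
def iterDiff (X : List ((k : Fin m) × G k)) (f : (∀ k, G k) → ℤ) : (∀ k, G k) → ℤ :=
  X.foldr (fun q f p => f p - f (Pi.mulSingle q.1 q.2 * p)) f

lemma iterDiff_cons (q : (k : Fin m) × G k) (X : List ((k : Fin m) × G k))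
    (f : (∀ k, G k) → ℤ) (p : ∀ k, G k) :
    iterDiff (q :: X) f p = iterDiff X f p - iterDiff X f (Pi.mulSingle q.1 q.2 * p) := rfl

lemma pcomm_eq_of_mul_eq {H : Type*} [Group H] {a b c : H} (h : a * b = b * a * c) :
    pcomm a b = c := by
  rw [pcomm, mul_assoc, h]
  group

lemma pcomm_shearHom_fiberShift (F f : (∀ k, G k) → ℤ) (i : Fin m) (g : G i) :
    pcomm (shearHom F i g) (fiberShift f) =
      fiberShift fun p => f p - f (Pi.mulSingle i g * p) := by
  refine pcomm_eq_of_mul_eq (Equiv.ext fun ⟨a, p⟩ => ?_)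
  simp only [Equiv.Perm.mul_apply, shearHom_apply, fiberShift_apply, Prod.mk.injEq, and_true]
  ring

lemma pcomm_shearHom_shearHom {F F' f : (∀ k, G k) → ℤ} {i j : Fin m} (hij : i ≠ j)
    (g : G i) (h : G j) (hf : ∀ p, f p = F' p - F p) :
    pcomm (shearHom F' j h) (shearHom F i g) = fiberShift (iterDiff [⟨j, h⟩, ⟨i, g⟩] f) := by
  refine pcomm_eq_of_mul_eq (Equiv.ext fun ⟨a, p⟩ => ?_)
  have hc : Pi.mulSingle j h * (Pi.mulSingle i g * p) =
      Pi.mulSingle i g * (Pi.mulSingle j h * p) :=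
    (Pi.mulSingle_commute hij.symm h g).left_comm p
  simp only [Equiv.Perm.mul_apply, shearHom_apply, fiberShift_apply, hc, iterDiff,
    List.foldr_cons, List.foldr_nil, hf, Prod.mk.injEq, and_true]
  ring

lemma shearLift_nested (F : Fin m → (∀ k, G k) → ℤ) (hF) {f : (∀ k, G k) → ℤ}
    {i j : Fin m} (hij : i ≠ j) (gi : G i) (gj : G j) (hf : ∀ p, f p = F j p - F i p)
    (L : List ((k : Fin m) × G k)) :
    shearLift K F hF (nested K L (pcomm (gpOf K G j gj) (gpOf K G i gi))) =
      fiberShift (iterDiff (L ++ [⟨j, gj⟩, ⟨i, gi⟩]) f) := by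
  have hpc : ∀ x y, shearLift K F hF (pcomm x y) =
      pcomm (shearLift K F hF x) (shearLift K F hF y) := by simp [pcomm]
  induction L with
  | nil =>
    rw [nested, List.foldr_nil, hpc, shearLift_gpOf, shearLift_gpOf,
      pcomm_shearHom_shearHom hij gi gj hf]
    rfl
  | cons a L ih =>
    change shearLift K F hF (pcomm (gpOf K G a.1 a.2) (nested K L _)) = _
    rw [hpc, ih, shearLift_gpOf, pcomm_shearHom_fiberShift]
    rfl

open Classical in
/-- The function equal to `c` where the coordinates agree with the nontrivial coordinates of `v`,
and zero elsewhere. -/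
noncomputable def boxInd (v : ∀ k, G k) (c : ℤ) (p : ∀ k, G k) : ℤ :=
  if ∀ k, v k ≠ 1 → p k = v k then c else 0

open Classical in
lemma boxInd_mulSingle_mul {v : ∀ k, G k} {i : Fin m} (hi : v i = 1) (c : ℤ) (g : G i)
    (p : ∀ k, G k) : boxInd v c (Pi.mulSingle i g * p) = boxInd v c p := by
  have : ∀ k, (v k ≠ 1 → (Pi.mulSingle i g * p : ∀ k, G k) k = v k) ↔ (v k ≠ 1 → p k = v k) := by
    intro k
    rcases eq_or_ne k i with rfl | h
    · simp [hi]
    · simp [h]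
  exact if_congr (forall_congr' this) rfl rfl

lemma boxInd_sub (v : ∀ k, G k) (c d : ℤ) (p : ∀ k, G k) :
    boxInd v (c - d) p = boxInd v c p - boxInd v d p := by
  unfold boxInd
  split_ifs <;> simp

open Classical in
lemma iterDiff_boxInd (v : ∀ k, G k) (c : ℤ) (X : List ((k : Fin m) × G k))
    (hX : (X.map Sigma.fst).Nodup) (hX1 : ∀ q ∈ X, q.2 ≠ 1) (p : ∀ k, G k)
    (hp : ∀ q ∈ X, p q.1 = 1) :
    iterDiff X (boxInd v c) p =
      if (∀ q ∈ X, v q.1 = q.2) ∧ ∀ k, v k ≠ 1 → k ∉ X.map Sigma.fst → p k = v k then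
        (-1) ^ X.length * c else 0 := by
  induction X generalizing p with
  | nil => simp [iterDiff, boxInd]
  | cons a X ih =>
    rw [List.map_cons, List.nodup_cons] at hX
    have hne : ∀ q ∈ X, q.1 ≠ a.1 := fun q hq h => hX.1 (h ▸ List.mem_map_of_mem hq)
    have hX1' : ∀ q ∈ X, q.2 ≠ 1 := fun q hq => hX1 q (List.mem_cons_of_mem _ hq)
    have hp' : ∀ q ∈ X, p q.1 = 1 := fun q hq => hp q (List.mem_cons_of_mem _ hq)
    have ha1 : a.2 ≠ 1 := hX1 a List.mem_cons_self
    have hpa : p a.1 = 1 := hp a List.mem_cons_self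
    rw [iterDiff_cons, ih hX.2 hX1' p hp', ih hX.2 hX1' (Pi.mulSingle a.1 a.2 * p)
      fun q hq => by simp [hne q hq, hp' q hq]]
    have hself : (Pi.mulSingle a.1 a.2 * p : ∀ k, G k) a.1 = a.2 := by simp [hpa]
    have hoff : ∀ k, k ≠ a.1 → (Pi.mulSingle a.1 a.2 * p : ∀ k, G k) k = p k := by
      intro k hk; simp [hk]
    generalize (Pi.mulSingle a.1 a.2 * p : ∀ k, G k) = p' at hself hoff
    by_cases hva : v a.1 = a.2
    · rw [if_neg (fun h => ha1 (by
        rw [← hva, ← h.2 a.1 (by rwa [hva]) hX.1, hpa]))]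
      have : ((∀ q ∈ X, v q.1 = q.2) ∧ ∀ k, v k ≠ 1 → k ∉ X.map Sigma.fst → p' k = v k) ↔
          ((∀ q ∈ a :: X, v q.1 = q.2) ∧
            ∀ k, v k ≠ 1 → k ∉ (a :: X).map Sigma.fst → p k = v k) := by
        refine and_congr (by simp [hva]) (forall_congr' fun k => ?_)
        rcases eq_or_ne k a.1 with rfl | h
        · simp [hself, hva]
        · rw [hoff k h, List.map_cons, List.mem_cons]
          simp [h]
      simp only [this, List.length_cons]
      split_ifs
      · ring
      · ring
    · rw [if_neg (c := (∀ q ∈ a :: X, v q.1 = q.2) ∧ _)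
        (fun h => hva (h.1 a List.mem_cons_self)), sub_eq_zero]
      congr 1
      refine propext (and_congr_right fun _ => forall_congr' fun k => ?_)
      rcases eq_or_ne k a.1 with rfl | h
      · have : (1 : G a.1) = v a.1 → v a.1 = 1 := Eq.symm
        rw [hself, hpa]
        have h2 : a.2 ≠ v a.1 := Ne.symm hva
        have h3 : a.1 ∉ X.map Sigma.fst := hX.1
        tauto
      · rw [hoff k h]

lemma exists_eq_on_list (X : List ((k : Fin m) × G k)) (hX : (X.map Sigma.fst).Nodup) :
    ∃ v : ∀ k, G k, (∀ q ∈ X, v q.1 = q.2) ∧ ∀ k, k ∉ X.map Sigma.fst → v k = 1 := by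
  induction X with
  | nil => exact ⟨1, by simp⟩
  | cons a X ih =>
    rw [List.map_cons, List.nodup_cons] at hX
    obtain ⟨v, hv, hv1⟩ := ih hX.2
    refine ⟨update v a.1 a.2, ?_, ?_⟩
    · intro q hq
      rcases List.mem_cons.1 hq with rfl | hq
      · simp
      · rw [update_of_ne (fun h : q.1 = a.1 => hX.1 (h ▸ List.mem_map_of_mem hq)), hv q hq]
    · intro k hk
      rw [List.map_cons, List.mem_cons, not_or] at hk
      rw [update_of_ne hk.1, hv1 k hk.2]

open Classical in
/-- The indicator function of the component of `i` in the full subgraph on `supp v`. -/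
noncomputable def compInd (K : Finset (Finset (Fin m))) (v : ∀ k, G k) (i k : Fin m) : ℤ :=
  if (graphOn m K (supp v)).Reachable i k then 1 else 0

lemma commute_compInd (v : ∀ k, G k) (i₀ : Fin m) (i j : Fin m) (g : G i) (h : G j) (hij : i ≠ j)
    (hK : ({i, j} : Finset (Fin m)) ∈ K) :
    Commute (shearHom (boxInd v (compInd K v i₀ i)) i g)
      (shearHom (boxInd v (compInd K v i₀ j)) j h) := by
  refine commute_shearHom hij g h fun p => ?_
  by_cases hi : v i = 1
  · simp only [boxInd_mulSingle_mul hi]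
    ring
  by_cases hj : v j = 1
  · have hc : Pi.mulSingle i g * (Pi.mulSingle j h * p) =
        Pi.mulSingle j h * (Pi.mulSingle i g * p) :=
      (Pi.mulSingle_commute hij g h).left_comm p
    simp only [hc, boxInd_mulSingle_mul hj]
    ring
  · have hadj : (graphOn m K (supp v)).Reachable i j :=
      (graphOn_adj.2 ⟨hij, by simpa using hi, by simpa using hj, hK⟩).reachable
    have : compInd K v i₀ i = compInd K v i₀ j := by
      simp only [compInd]
      congr 1
      exact propext ⟨fun h => h.trans hadj, fun h => h.trans hadj.symm⟩
    rw [this]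

/-- The conditions of `gpCommSet` on the entries of a nested commutator. -/
structure IsBasic (K : Finset (Finset (Fin m))) (L : List ((k : Fin m) × G k)) (j i : Fin m)
    (gj : G j) (gi : G i) : Prop where
  chain : (L.map Sigma.fst).IsChain (· < ·)
  lt_max : ∀ p ∈ L, p.1 < j
  lt : i < j
  ne : ∀ p ∈ L, p.1 ≠ i
  ne_one : ∀ p ∈ L, p.2 ≠ 1
  left_ne_one : gj ≠ 1
  right_ne_one : gi ≠ 1
  not_reachable : ¬ (graphOn m K ((L.map Sigma.fst).toFinset ∪ {j, i})).Reachable i j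
  min : ∀ i' : Fin m,
    (graphOn m K ((L.map Sigma.fst).toFinset ∪ {j, i})).Reachable i i' → i ≤ i'

/-- The element `v` of the direct product has exactly the entries of `X` as its nontrivial
coordinates. -/
def Records (v : ∀ k, G k) (X : List ((k : Fin m) × G k)) : Prop :=
  (∀ q ∈ X, v q.1 = q.2) ∧ ∀ k, v k ≠ 1 → k ∈ X.map Sigma.fst

namespace IsBasic

variable {L : List ((k : Fin m) × G k)} {j i : Fin m} {gj : G j} {gi : G i}

lemma nodup (h : IsBasic K L j i gj gi) :
    ((L ++ [⟨j, gj⟩, ⟨i, gi⟩] : List ((k : Fin m) × G k)).map Sigma.fst).Nodup := by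
  rw [List.map_append, List.nodup_append]
  refine ⟨h.chain.pairwise.nodup, by simp [h.lt.ne'], ?_⟩
  rintro a ha b hb rfl
  obtain ⟨p, hp, rfl⟩ := List.mem_map.1 ha
  simp only [List.map_cons, List.map_nil, List.mem_cons, List.not_mem_nil, or_false] at hb
  rcases hb with hb | hb
  · exact (h.lt_max p hp).ne hb
  · exact h.ne p hp hb

lemma entry_ne_one (h : IsBasic K L j i gj gi) :
    ∀ q ∈ L ++ [⟨j, gj⟩, ⟨i, gi⟩], q.2 ≠ 1 := by
  intro q hq
  simp only [List.mem_append, List.mem_cons, List.not_mem_nil, or_false] at hq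
  rcases hq with hq | rfl | rfl
  · exact h.ne_one q hq
  · exact h.left_ne_one
  · exact h.right_ne_one

lemma le_max (h : IsBasic K L j i gj gi) : ∀ q ∈ L ++ [⟨j, gj⟩, ⟨i, gi⟩], q.1 ≤ j := by
  intro q hq
  simp only [List.mem_append, List.mem_cons, List.not_mem_nil, or_false] at hq
  rcases hq with hq | rfl | rfl
  · exact (h.lt_max q hq).le
  · exact le_rfl
  · exact h.lt.le

lemma mem_list_iff (h : IsBasic K L j i gj gi) (q : (k : Fin m) × G k) :
    q ∈ L ↔ q ∈ L ++ [⟨j, gj⟩, ⟨i, gi⟩] ∧ q.1 ≠ j ∧ q.1 ≠ i := by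
  simp only [List.mem_append, List.mem_cons, List.not_mem_nil, or_false]
  constructor
  · exact fun hq => ⟨.inl hq, (h.lt_max q hq).ne, h.ne q hq⟩
  · rintro ⟨hq | rfl | rfl, h1, h2⟩
    · exact hq
    · exact absurd rfl h1
    · exact absurd rfl h2

lemma mem_iff_of_records (h : IsBasic K L j i gj gi) {v : ∀ k, G k}
    (hv : Records v (L ++ [⟨j, gj⟩, ⟨i, gi⟩])) (q : (k : Fin m) × G k) :
    q ∈ L ++ [⟨j, gj⟩, ⟨i, gi⟩] ↔ v q.1 = q.2 ∧ q.2 ≠ 1 := by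
  refine ⟨fun hq => ⟨hv.1 q hq, h.entry_ne_one q hq⟩, fun ⟨h1, h2⟩ => ?_⟩
  obtain ⟨⟨k, g⟩, hr, hk⟩ := List.mem_map.1 (hv.2 q.1 (by rwa [h1]))
  obtain ⟨k', g'⟩ := q
  obtain rfl : k = k' := hk
  have : g = g' := (hv.1 _ hr).symm.trans h1
  rwa [← this]

lemma supp_eq_of_records (h : IsBasic K L j i gj gi) {v : ∀ k, G k}
    (hv : Records v (L ++ [⟨j, gj⟩, ⟨i, gi⟩])) :
    (L.map Sigma.fst).toFinset ∪ {j, i} = supp v := by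
  have e : ∀ k, k ∈ (L.map Sigma.fst).toFinset ∪ {j, i} ↔
      k ∈ (L ++ [⟨j, gj⟩, ⟨i, gi⟩] : List ((k : Fin m) × G k)).map Sigma.fst := by
    intro k
    simp only [Finset.mem_union, List.mem_toFinset, Finset.mem_insert, Finset.mem_singleton,
      List.map_append, List.map_cons, List.map_nil, List.mem_append, List.mem_cons,
      List.not_mem_nil, or_false]
  ext k
  rw [e, mem_supp]
  refine ⟨fun hk => ?_, hv.2 k⟩
  obtain ⟨q, hq, rfl⟩ := List.mem_map.1 hk
  rw [hv.1 q hq]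
  exact h.entry_ne_one q hq

lemma exists_records (h : IsBasic K L j i gj gi) :
    ∃ v : ∀ k, G k, Records v (L ++ [⟨j, gj⟩, ⟨i, gi⟩]) := by
  obtain ⟨v, hv, hv1⟩ := exists_eq_on_list _ h.nodup
  exact ⟨v, hv, fun k hk => by by_contra hk'; exact hk (hv1 k hk')⟩

lemma iterDiff_ne_zero_iff (h : IsBasic K L j i gj gi) (v : ∀ k, G k) (c : ℤ) :
    iterDiff (L ++ [⟨j, gj⟩, ⟨i, gi⟩]) (boxInd v c) 1 ≠ 0 ↔
      c ≠ 0 ∧ Records v (L ++ [⟨j, gj⟩, ⟨i, gi⟩]) := by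
  classical
  rw [iterDiff_boxInd v c _ h.nodup h.entry_ne_one 1 fun _ _ => rfl]
  have e : ∀ k, (v k ≠ 1 → k ∉ (L ++ [⟨j, gj⟩, ⟨i, gi⟩] : List ((k : Fin m) × G k)).map Sigma.fst →
      (1 : ∀ k, G k) k = v k) ↔
      (v k ≠ 1 → k ∈ (L ++ [⟨j, gj⟩, ⟨i, gi⟩] : List ((k : Fin m) × G k)).map Sigma.fst) := by
    intro k
    rw [Pi.one_apply, eq_comm]
    tauto
  have hiff : ((∀ q ∈ L ++ [⟨j, gj⟩, ⟨i, gi⟩], v q.1 = q.2) ∧ ∀ k, v k ≠ 1 →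
      k ∉ (L ++ [⟨j, gj⟩, ⟨i, gi⟩] : List ((k : Fin m) × G k)).map Sigma.fst →
        (1 : ∀ k, G k) k = v k) ↔ Records v (L ++ [⟨j, gj⟩, ⟨i, gi⟩]) :=
    and_congr_right fun _ => forall_congr' e
  rw [← hiff, Ne, ite_eq_right_iff]
  rw [Classical.not_imp, mul_eq_zero, or_iff_right (pow_ne_zero _ (by norm_num))]
  exact and_comm

lemma nested_eq_of_records {L' : List ((k : Fin m) × G k)} {j' i' : Fin m} {gj' : G j'}
    {gi' : G i'} (h : IsBasic K L j i gj gi) (h' : IsBasic K L' j' i' gj' gi') {v : ∀ k, G k}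
    (hv : Records v (L ++ [⟨j, gj⟩, ⟨i, gi⟩])) (hv' : Records v (L' ++ [⟨j', gj'⟩, ⟨i', gi'⟩]))
    (hc : compInd K v i j' - compInd K v i i' ≠ 0) :
    nested K L' (pcomm (gpOf K G j' gj') (gpOf K G i' gi')) =
      nested K L (pcomm (gpOf K G j gj) (gpOf K G i gi)) := by
  have hmem : ∀ q, q ∈ L ++ [⟨j, gj⟩, ⟨i, gi⟩] ↔ q ∈ L' ++ [⟨j', gj'⟩, ⟨i', gi'⟩] := fun q =>
    (h.mem_iff_of_records hv q).trans (h'.mem_iff_of_records hv' q).symm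
  obtain rfl : j = j' := le_antisymm
    (h'.le_max ⟨j, gj⟩ ((hmem _).1 (by simp))) (h.le_max ⟨j', gj'⟩ ((hmem _).2 (by simp)))
  have hmin := h.min
  have hmin' := h'.min
  have hnr := h.not_reachable
  rw [h.supp_eq_of_records hv] at hmin hnr
  rw [h'.supp_eq_of_records hv'] at hmin'
  have hr : (graphOn m K (supp v)).Reachable i i' := by
    by_contra hr
    simp [compInd, hnr, hr] at hc
  obtain rfl : i = i' := le_antisymm (hmin _ hr) (hmin' _ hr.symm)
  obtain rfl : gj = gj' := (hv.1 ⟨j, gj⟩ (by simp)).symm.trans (hv'.1 ⟨j, gj'⟩ (by simp))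
  obtain rfl : gi = gi' := (hv.1 ⟨i, gi⟩ (by simp)).symm.trans (hv'.1 ⟨i, gi'⟩ (by simp))
  have hL : ∀ q, q ∈ L ↔ q ∈ L' := fun q => by
    rw [h.mem_list_iff, h'.mem_list_iff, hmem]
  have hperm : L.Perm L' := (List.perm_ext_iff_of_nodup
    (List.Nodup.of_map _ h.chain.pairwise.nodup)
    (List.Nodup.of_map _ h'.chain.pairwise.nodup)).2 hL
  rw [hperm.eq_of_pairwise (fun a b _ _ hab hba => absurd hab (lt_asymm hba))
    (List.pairwise_map.1 h.chain.pairwise) (List.pairwise_map.1 h'.chain.pairwise)]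

end IsBasic

lemma exists_isBasic {x : GraphProduct m K G} (hx : x ∈ gpCommSet m K G) :
    ∃ (L : List ((k : Fin m) × G k)) (j i : Fin m) (gj : G j) (gi : G i),
      IsBasic K L j i gj gi ∧ x = nested K L (pcomm (gpOf K G j gj) (gpOf K G i gi)) := by
  obtain ⟨L, j, i, gj, gi, h1, h2, h3, h4, h5, h6, h7, -, h8, h9, rfl⟩ := hx
  exact ⟨L, j, i, gj, gi, ⟨h1, h2, h3, h4, h5, h6, h7, h8, h9⟩, rfl⟩

lemma notMem_closure_of_notMem {T : Set (GraphProduct m K G)} (hT : T ⊆ gpCommSet m K G)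
    {s : GraphProduct m K G} (hs : s ∈ gpCommSet m K G) (hsT : s ∉ T) :
    s ∉ Subgroup.closure T := by
  obtain ⟨L, j, i, gj, gi, h, rfl⟩ := exists_isBasic hs
  obtain ⟨v, hv⟩ := h.exists_records
  set Ψ := shearLift K (fun k => boxInd v (compInd K v i k)) (commute_compInd v i)
  have hfix : ∀ f : (∀ k, G k) → ℤ, fiberShift f ∈
      MulAction.stabilizer (Equiv.Perm (ℤ × ∀ k, G k)) ((0, 1) : ℤ × ∀ k, G k) ↔ f 1 = 0 := by
    intro f
    rw [MulAction.mem_stabilizer_iff, Equiv.Perm.smul_def, fiberShift_apply]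
    simp
  have hΨ : ∀ {L' : List ((k : Fin m) × G k)} {j' i' : Fin m} {gj' : G j'} {gi' : G i'},
      IsBasic K L' j' i' gj' gi' →
      Ψ (nested K L' (pcomm (gpOf K G j' gj') (gpOf K G i' gi'))) = fiberShift
        (iterDiff (L' ++ [⟨j', gj'⟩, ⟨i', gi'⟩])
          (boxInd v (compInd K v i j' - compInd K v i i'))) := fun h' =>
    shearLift_nested _ _ h'.lt.ne _ _ (fun p => boxInd_sub _ _ _ p) _
  have hle : Subgroup.closure T ≤ (MulAction.stabilizer (Equiv.Perm (ℤ × ∀ k, G k))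
      ((0, 1) : ℤ × ∀ k, G k)).comap Ψ := by
    rw [Subgroup.closure_le]
    intro t ht
    obtain ⟨L', j', i', gj', gi', h', rfl⟩ := exists_isBasic (hT ht)
    rw [SetLike.mem_coe, Subgroup.mem_comap, hΨ h', hfix]
    by_contra hne
    obtain ⟨hc, hv'⟩ := (h'.iterDiff_ne_zero_iff v _).1 hne
    rw [h.nested_eq_of_records h' hv hv' hc] at ht
    exact hsT ht
  intro hmem
  have h0 := hle hmem
  rw [Subgroup.mem_comap, hΨ h, hfix] at h0
  refine (h.iterDiff_ne_zero_iff v _).2 ⟨?_, hv⟩ h0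
  have hnr := h.not_reachable
  rw [h.supp_eq_of_records hv] at hnr
  simp [compInd, hnr]

end Independence

end GraphProduct

/-- For a flag simplicial complex `K` on `m` vertices, nontrivial groups `G₁, …, G_m`, and the
canonical projection `φ : G^K → G₁ × ⋯ × G_m`, the set of basic nested iterated commutators is
a minimal generating set of `ker φ`: it generates `ker φ`, and no proper subset of it
generates `ker φ`. -/
theorem graph_product_kernel_minimal_generating_set (m : ℕ) (K : Finset (Finset (Fin m)))
    (hdown : ∀ I ∈ K, ∀ J ⊆ I, J ∈ K) (hempty : (∅ : Finset (Fin m)) ∈ K)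
    (hsingle : ∀ i : Fin m, ({i} : Finset (Fin m)) ∈ K)
    (hflag : ∀ J : Finset (Fin m),
      (∀ i ∈ J, ∀ j ∈ J, i ≠ j → ({i, j} : Finset (Fin m)) ∈ K) → J ∈ K)
    (G : Fin m → Type) [∀ i, Group (G i)] [∀ i, Nontrivial (G i)]
    (φ : GraphProduct m K G →* (∀ i, G i))
    (hφ : ∀ (i : Fin m) (g : G i), φ (gpOf K G i g) = Pi.mulSingle i g) :
    Subgroup.closure (gpCommSet m K G) = φ.ker ∧
      ∀ T ⊂ gpCommSet m K G, Subgroup.closure T ≠ φ.ker := by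
  refine ⟨le_antisymm ((Subgroup.closure_le _).2 (GraphProduct.gpCommSet_subset_ker φ hφ))
    (GraphProduct.ker_le_closure φ hφ), fun T hT hcl => ?_⟩
  obtain ⟨s, hs, hsT⟩ := Set.exists_of_ssubset hT
  refine GraphProduct.notMem_closure_of_notMem hT.1 hs hsT ?_
  rw [hcl]
  exact GraphProduct.gpCommSet_subset_ker φ hφ hs
end
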